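/- arXiv:2409.02125 — 9 statements merged into one kernel-verified Lean document; each statement's English description precedes it below -/
import Mathlib

section
/- Let G be a strongly connected digraph with at least one arc. Then the diameter of the line digraph LG equals the diameter of G, i.e. D(LG) = D(G), if and only if G is a directed cycle. -/
/-- A digraph: a vertex type together with an adjacency (arc) relation.
(Loops allowed, no multiple arcs.) -/
structure Digraph' where
  V : Type
  Adj : V → V → Prop

namespace Digraph'

/-- `G.HasWalk k u v` means there is a directed walk of length `k` from `u` to `v`. -/
def HasWalk (G : Digraph') : ℕ → G.V → G.V → Prop
  | 0, u, v => u = v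
  | (k + 1), u, v => ∃ w, G.Adj u w ∧ G.HasWalk k w v

/-- There is a directed walk from `u` to `v`. -/
def Reachable (G : Digraph') (u v : G.V) : Prop := ∃ k, G.HasWalk k u v

/-- The distance from `u` to `v`: the length of a shortest directed path
(junk value `0` when `v` is not reachable from `u`). -/
noncomputable def dist (G : Digraph') (u v : G.V) : ℕ := sInf {k | G.HasWalk k u v}

/-- A digraph is strongly connected when every vertex is reachable from every vertex. -/
def StronglyConnected (G : Digraph') : Prop := ∀ u v : G.V, G.Reachable u v

/-- The (standard) diameter: maximum distance over all ordered pairs of vertices. -/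
noncomputable def diam (G : Digraph') : ℕ := sSup {n | ∃ u v : G.V, G.dist u v = n}

/-- The inner diameter: maximum of the finite distances. -/
noncomputable def innerDiam (G : Digraph') : ℕ :=
  sSup {n | ∃ u v : G.V, G.Reachable u v ∧ G.dist u v = n}

/-- Inner out-eccentricity of a vertex. -/
noncomputable def eccOut (G : Digraph') (u : G.V) : ℕ :=
  sSup {n | ∃ v : G.V, G.Reachable u v ∧ G.dist u v = n}

/-- Inner in-eccentricity of a vertex. -/
noncomputable def eccIn (G : Digraph') (u : G.V) : ℕ :=
  sSup {n | ∃ v : G.V, G.Reachable v u ∧ G.dist v u = n}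

/-- Inner out-diameter `d⁺(G)`. -/
noncomputable def innerDiamOut (G : Digraph') : ℕ := sSup (Set.range G.eccOut)

/-- Inner in-diameter `d⁻(G)`. -/
noncomputable def innerDiamIn (G : Digraph') : ℕ := sSup (Set.range G.eccIn)

/-- Inner out-radius `r⁺(G)`. -/
noncomputable def radiusOut (G : Digraph') : ℕ := sInf (Set.range G.eccOut)

/-- Inner in-radius `r⁻(G)`. -/
noncomputable def radiusIn (G : Digraph') : ℕ := sInf (Set.range G.eccIn)

/-- The line digraph: vertices are the arcs of `G`, and arc `(u,v)` is adjacent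
to arc `(w,z)` iff `v = w`. -/
def line (G : Digraph') : Digraph' where
  V := {p : G.V × G.V // G.Adj p.1 p.2}
  Adj a b := a.val.2 = b.val.1

/-- The `k`-iterated line digraph. -/
def iterLine (G : Digraph') : ℕ → Digraph'
  | 0 => G
  | (k + 1) => (G.iterLine k).line

/-- Two digraphs are isomorphic. -/
def IsIsomorphic (G H : Digraph') : Prop :=
  ∃ e : G.V ≃ H.V, ∀ u v : G.V, G.Adj u v ↔ H.Adj (e u) (e v)

/-- The directed cycle on `n` vertices. -/
def cycleDigraph (n : ℕ) : Digraph' where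
  V := ZMod n
  Adj i j := j = i + 1

/-- A digraph is a directed cycle if it is isomorphic to `C_n` for some `n ≥ 1`. -/
def IsDirectedCycle (G : Digraph') : Prop :=
  ∃ n : ℕ, 1 ≤ n ∧ G.IsIsomorphic (cycleDigraph n)

end Digraph'

namespace Digraph'

theorem dist_le {G : Digraph'} {k : ℕ} {u v : G.V} (h : G.HasWalk k u v) : G.dist u v ≤ k :=
  Nat.sInf_le h

theorem dist_walk {G : Digraph'} {u v : G.V} (h : G.Reachable u v) :
    G.HasWalk (G.dist u v) u v :=
  Nat.sInf_mem (s := {k | G.HasWalk k u v}) h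

theorem walk_snoc {G : Digraph'} (k : ℕ) (u v : G.V) :
    G.HasWalk (k + 1) u v ↔ ∃ w, G.HasWalk k u w ∧ G.Adj w v := by
  induction k generalizing u with
  | zero => simp [HasWalk]
  | succ k ih =>
    constructor
    · rintro ⟨x, hx, h⟩
      obtain ⟨w, hw, ha⟩ := (ih x).1 h
      exact ⟨w, ⟨x, hx, hw⟩, ha⟩
    · rintro ⟨w, ⟨x, hx, hw⟩, ha⟩
      exact ⟨x, hx, (ih x).2 ⟨w, hw, ha⟩⟩

theorem line_walk {G : Digraph'} (k : ℕ) (e f : G.line.V) :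
    G.line.HasWalk (k + 1) e f → G.HasWalk k e.val.2 f.val.1 := by
  induction k generalizing e with
  | zero =>
    rintro ⟨w, hw, h⟩
    have h' : w = f := h
    subst h'
    exact hw
  | succ k ih =>
    rintro ⟨w, hw, h⟩
    have hw' : e.val.2 = w.val.1 := hw
    refine ⟨w.val.2, ?_, ih w h⟩
    rw [hw']
    exact w.property

theorem walk_line {G : Digraph'} (k : ℕ) (e f : G.line.V) :
    G.HasWalk k e.val.2 f.val.1 → G.line.HasWalk (k + 1) e f := by
  induction k generalizing e with
  | zero =>
    intro h
    exact ⟨f, h, rfl⟩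
  | succ k ih =>
    rintro ⟨w, hw, h⟩
    exact ⟨⟨(e.val.2, w), hw⟩, rfl, ih ⟨(e.val.2, w), hw⟩ h⟩

theorem diam_set_finite (G : Digraph') [Finite G.V] :
    {n | ∃ u v : G.V, G.dist u v = n}.Finite := by
  refine (Set.finite_range (fun p : G.V × G.V => G.dist p.1 p.2)).subset ?_
  rintro n ⟨u, v, rfl⟩
  exact ⟨(u, v), rfl⟩

theorem dist_le_diam (G : Digraph') [Finite G.V] (u v : G.V) : G.dist u v ≤ G.diam :=
  le_csSup (diam_set_finite G).bddAbove ⟨u, v, rfl⟩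

theorem exists_diam (G : Digraph') [Finite G.V] (x : G.V) : ∃ u v : G.V, G.dist u v = G.diam :=
  Nat.sSup_mem (s := {n | ∃ u v : G.V, G.dist u v = n}) ⟨_, x, x, rfl⟩
    (diam_set_finite G).bddAbove

theorem iso_walk {G H : Digraph'} (e : G.V ≃ H.V)
    (he : ∀ u v : G.V, G.Adj u v ↔ H.Adj (e u) (e v)) (k : ℕ) (u v : G.V) :
    G.HasWalk k u v ↔ H.HasWalk k (e u) (e v) := by
  induction k generalizing u with
  | zero => exact e.injective.eq_iff.symm
  | succ k ih =>
    constructor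
    · rintro ⟨w, hw, h⟩
      exact ⟨e w, (he _ _).1 hw, (ih w).1 h⟩
    · rintro ⟨w, hw, h⟩
      obtain ⟨w, rfl⟩ := e.surjective w
      exact ⟨w, (he _ _).2 hw, (ih w).2 h⟩

theorem iso_diam {G H : Digraph'} (h : G.IsIsomorphic H) : G.diam = H.diam := by
  obtain ⟨e, he⟩ := h
  have hd : ∀ u v, G.dist u v = H.dist (e u) (e v) := by
    intro u v
    unfold dist
    congr 1
    ext k
    exact iso_walk e he k u v
  unfold diam
  congr 1
  ext n
  constructor
  · rintro ⟨u, v, h⟩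
    exact ⟨e u, e v, by rw [← hd, h]⟩
  · rintro ⟨u, v, h⟩
    exact ⟨e.symm u, e.symm v, by rw [hd]; simpa using h⟩

theorem line_iso_of_cycle {G : Digraph'} (h : G.IsDirectedCycle) : G.IsIsomorphic G.line := by
  obtain ⟨n, -, e', he'⟩ := h
  obtain ⟨e, he⟩ : ∃ e : G.V ≃ ZMod n, ∀ u v, G.Adj u v ↔ e v = e u + 1 := ⟨e', he'⟩
  let f : G.V → G.V := fun u => e.symm (e u + 1)
  have hf : ∀ u v, G.Adj u v ↔ v = f u := by
    intro u v
    rw [he]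
    exact (Equiv.eq_symm_apply e).symm
  refine ⟨⟨fun u => ⟨(u, f u), (hf _ _).2 rfl⟩, fun a => a.val.1, fun u => rfl, ?_⟩, ?_⟩
  · rintro ⟨⟨a, b⟩, hab⟩
    exact Subtype.ext (Prod.ext rfl ((hf _ _).1 hab).symm)
  · intro u v
    rw [hf]
    exact eq_comm

theorem cycle_of_fun {G : Digraph'} (hsc : G.StronglyConnected) (f : G.V → G.V)
    (hf : ∀ u v, G.Adj u v ↔ v = f u) (x : G.V) : G.IsDirectedCycle := by
  have hw : ∀ k u v, G.HasWalk k u v → f^[k] u = v := by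
    intro k
    induction k with
    | zero => intro u v h; exact h
    | succ k ih =>
      rintro u v ⟨w, hw, h⟩
      rw [Function.iterate_succ_apply, ← (hf _ _).1 hw]
      exact ih _ _ h
  have hpos : 0 < Function.minimalPeriod f x := by
    obtain ⟨k, hk⟩ := hsc (f x) x
    refine Function.IsPeriodicPt.minimalPeriod_pos (n := k + 1) (Nat.succ_pos _) ?_
    exact hw (k + 1) x x ⟨f x, (hf _ _).2 rfl, hk⟩
  set n := Function.minimalPeriod f x with hn
  have : NeZero n := ⟨hpos.ne'⟩
  let g : ZMod n → G.V := fun i => f^[i.val] x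
  have hg : Function.Bijective g := by
    constructor
    · intro i j hij
      exact ZMod.val_injective n
        (Function.iterate_injOn_Iio_minimalPeriod (ZMod.val_lt i) (ZMod.val_lt j) hij)
    · intro v
      obtain ⟨k, hk⟩ := hsc x v
      refine ⟨(k : ZMod n), ?_⟩
      change f^[((k : ZMod n)).val] x = v
      rw [ZMod.val_natCast, hn, Function.iterate_mod_minimalPeriod_eq]
      exact hw _ _ _ hk
  have hs : ∀ i, g (i + 1) = f (g i) := by
    intro i
    change f^[(i + 1).val] x = f (f^[i.val] x)
    rw [← Function.iterate_succ_apply' f]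
    have : i + 1 = ((i.val + 1 : ℕ) : ZMod n) := by simp
    rw [this, ZMod.val_natCast]
    exact Function.iterate_mod_minimalPeriod_eq
  let e := Equiv.ofBijective g hg
  suffices h : ∀ u v, G.Adj u v ↔ e.symm v = e.symm u + 1 from ⟨n, hpos, e.symm, h⟩
  intro u v
  obtain ⟨i, rfl⟩ := e.surjective u
  obtain ⟨j, rfl⟩ := e.surjective v
  rw [hf, Equiv.symm_apply_apply, Equiv.symm_apply_apply]
  change g j = f (g i) ↔ j = i + 1
  rw [← hs]
  exact hg.injective.eq_iff

theorem cycle_of_diam (G : Digraph') [Finite G.V] (hsc : G.StronglyConnected)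
    (harc : ∃ u v : G.V, G.Adj u v) (hd : G.line.diam = G.diam) : G.IsDirectedCycle := by
  obtain ⟨x, y, hxy⟩ := harc
  have hout : ∀ u, ∃ v, G.Adj u v := by
    intro u
    obtain ⟨k, hk⟩ := hsc u x
    cases k with
    | zero => exact ⟨y, (show u = x from hk) ▸ hxy⟩
    | succ k => obtain ⟨w, hw, -⟩ := hk; exact ⟨w, hw⟩
  have hin : ∀ u, ∃ v, G.Adj v u := by
    intro u
    obtain ⟨k, hk⟩ := hsc y u
    cases k with
    | zero => exact ⟨x, (show y = u from hk) ▸ hxy⟩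
    | succ k => obtain ⟨w, -, hw⟩ := (walk_snoc _ _ _).1 hk; exact ⟨w, hw⟩
  have : Finite G.line.V := inferInstanceAs (Finite {p : G.V × G.V // G.Adj p.1 p.2})
  have key : ∀ a b c d, G.dist b c = G.diam → G.Adj a b → G.Adj c d → a = c ∧ b = d := by
    intro a b c d hbc hab hcd
    let e : G.line.V := ⟨(a, b), hab⟩
    let f : G.line.V := ⟨(c, d), hcd⟩
    have hr : G.line.Reachable e f := ⟨_, walk_line _ e f (dist_walk (hsc b c))⟩
    have h1 := dist_walk hr
    have h2 := dist_le_diam G.line e f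
    cases hk : G.line.dist e f with
    | zero =>
      rw [hk] at h1
      have h3 : e = f := h1
      have h4 : (a, b) = (c, d) := congrArg Subtype.val h3
      exact Prod.mk.inj h4
    | succ k =>
      rw [hk] at h1 h2
      have h3 : G.dist b c ≤ k := dist_le (line_walk k e f h1)
      omega
  have step : ∀ b v, (∃ c, G.dist b c = G.diam) → G.Adj b v →
      (∃ c, G.dist v c = G.diam) ∧ ∀ w, G.Adj b w → w = v := by
    rintro b v ⟨c, hc⟩ hbv
    obtain ⟨c', hc'⟩ := hin b
    obtain ⟨d', hd'⟩ := hout c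
    obtain ⟨rfl, rfl⟩ := key _ _ _ _ hc hc' hd'
    suffices h : ∃ v, G.Adj b v ∧ G.dist v b = G.diam by
      obtain ⟨w, hw, hwd⟩ := h
      have hu : ∀ z, G.Adj b z → z = w := fun z hz => ((key _ _ _ _ hwd hw hz).2).symm
      have := hu v hbv
      subst this
      exact ⟨⟨b, hwd⟩, hu⟩
    have hwalk := dist_walk (hsc b c')
    cases hD : G.dist b c' with
    | zero =>
      rw [hD] at hwalk
      have hbc : b = c' := hwalk
      subst hbc
      exact ⟨b, hd', hc⟩
    | succ k =>
      rw [hD] at hwalk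
      obtain ⟨w, hw, hwk⟩ := hwalk
      refine ⟨w, hw, le_antisymm (dist_le_diam _ _ _) ?_⟩
      have hwb := dist_walk (hsc w b)
      cases hm : G.dist w b with
      | zero =>
        rw [hm] at hwb
        have hwb' : w = b := hwb
        subst hwb'
        have := dist_le hwk
        omega
      | succ m =>
        rw [hm] at hwb
        obtain ⟨z, hz, hzb⟩ := (walk_snoc _ _ _).1 hwb
        obtain ⟨rfl, -⟩ := key _ _ _ _ hc hzb hd'
        have : G.dist b z ≤ m + 1 := dist_le ⟨w, hw, hz⟩
        omega
  have hall : ∀ u, ∃ c, G.dist u c = G.diam := by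
    obtain ⟨b, c, hbc⟩ := exists_diam G x
    have : ∀ k b u, (∃ c, G.dist b c = G.diam) → G.HasWalk k b u →
        ∃ c, G.dist u c = G.diam := by
      intro k
      induction k with
      | zero =>
        intro b u h hk
        exact (show b = u from hk) ▸ h
      | succ k ih =>
        rintro b u h ⟨w, hw, hk⟩
        exact ih w u (step b w h hw).1 hk
    intro u
    obtain ⟨k, hk⟩ := hsc b u
    exact this k b u ⟨c, hbc⟩ hk
  choose f hf using hout
  refine cycle_of_fun hsc f (fun u v => ⟨fun h => ?_, fun h => h ▸ hf u⟩) x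
  exact (step u (f u) (hall u) (hf u)).2 v h

end Digraph'

/-- For a strongly connected digraph `G` with at least one arc,
`D(LG) = D(G)` iff `G` is a directed cycle. -/
theorem stmt_0 (G : Digraph') [Finite G.V] (hsc : G.StronglyConnected)
    (harc : ∃ u v : G.V, G.Adj u v) :
    G.line.diam = G.diam ↔ G.IsDirectedCycle := by
  exact ⟨Digraph'.cycle_of_diam G hsc harc,
    fun h => (Digraph'.iso_diam (Digraph'.line_iso_of_cycle h)).symm⟩
end

section
/- Let G be a digraph with at least one arc, with inner diameter d(G). Then the inner diameter of its line digraph LG satisfies d(G) − 1 ≤ d(LG) ≤ d(G) + 1. -/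
theorem aux_line_walk (G : Digraph') : ∀ (k : ℕ) (e f : G.line.V),
    G.line.HasWalk (k + 1) e f ↔ G.HasWalk k e.1.2 f.1.1 := by
  intro k
  induction k with
  | zero =>
    intro e f
    constructor
    · rintro ⟨w, h, rfl⟩
      exact h
    · intro h
      exact ⟨f, h, rfl⟩
  | succ k ih =>
    intro e f
    constructor
    · rintro ⟨w, h, hw⟩
      have h' : e.1.2 = w.1.1 := h
      exact ⟨w.1.2, h' ▸ w.2, (ih w f).1 hw⟩
    · rintro ⟨w, h, hw⟩
      exact ⟨⟨(e.1.2, w), h⟩, rfl, (ih ⟨(e.1.2, w), h⟩ f).2 hw⟩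

theorem aux_snoc (G : Digraph') : ∀ (k : ℕ) (u v : G.V),
    G.HasWalk (k + 1) u v ↔ ∃ x, G.HasWalk k u x ∧ G.Adj x v := by
  intro k
  induction k with
  | zero =>
    intro u v
    constructor
    · rintro ⟨w, h, rfl⟩
      exact ⟨u, rfl, h⟩
    · rintro ⟨x, rfl, h⟩
      exact ⟨v, h, rfl⟩
  | succ k ih =>
    intro u v
    constructor
    · rintro ⟨w, h, hw⟩
      obtain ⟨x, hx, hxv⟩ := (ih w v).1 hw
      exact ⟨x, ⟨w, h, hx⟩, hxv⟩
    · rintro ⟨x, ⟨w, h, hx⟩, hxv⟩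
      exact ⟨w, h, (ih w v).2 ⟨x, hx, hxv⟩⟩

theorem aux_line_to (G : Digraph') (m : ℕ) (e f : G.line.V)
    (h : G.line.HasWalk m e f) : G.HasWalk (m + 1) e.1.1 f.1.2 := by
  cases m with
  | zero =>
    have h' : e = f := h
    subst h'
    exact ⟨e.1.2, e.2, rfl⟩
  | succ k =>
    exact ⟨e.1.2, e.2, (aux_snoc G k _ _).2 ⟨f.1.1, (aux_line_walk G k e f).1 h, f.2⟩⟩

theorem aux_dist_le (G : Digraph') {k : ℕ} {u v : G.V} (h : G.HasWalk k u v) :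
    G.dist u v ≤ k := Nat.sInf_le h

theorem aux_dist_walk (G : Digraph') {u v : G.V} (h : G.Reachable u v) :
    G.HasWalk (G.dist u v) u v := Nat.sInf_mem (s := {k | G.HasWalk k u v}) h

theorem aux_le_innerDiam (G : Digraph') [Finite G.V] {u v : G.V} (h : G.Reachable u v) :
    G.dist u v ≤ G.innerDiam := by
  refine le_csSup ?_ ⟨u, v, h, rfl⟩
  refine ((Set.finite_range (fun p : G.V × G.V => G.dist p.1 p.2)).subset ?_).bddAbove
  rintro n ⟨a, b, -, rfl⟩
  exact ⟨(a, b), rfl⟩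

theorem aux_innerDiam_le (G : Digraph') (n : ℕ)
    (h : ∀ u v : G.V, G.Reachable u v → G.dist u v ≤ n) : G.innerDiam ≤ n := by
  refine csSup_le' ?_
  rintro m ⟨u, v, hr, rfl⟩
  exact h u v hr

/-- For a digraph `G` with at least one arc,
`d(G) − 1 ≤ d(LG) ≤ d(G) + 1`. -/
theorem stmt_2 (G : Digraph') [Finite G.V] (harc : ∃ u v : G.V, G.Adj u v) :
    G.innerDiam - 1 ≤ G.line.innerDiam ∧ G.line.innerDiam ≤ G.innerDiam + 1 := by
  have hfin : Finite G.line.V := inferInstanceAs (Finite {p : G.V × G.V // G.Adj p.1 p.2})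
  constructor
  · rw [Nat.sub_le_iff_le_add]
    refine aux_innerDiam_le G _ fun u v hr => ?_
    have hw := aux_dist_walk G hr
    rcases hn : G.dist u v with _ | _ | n
    · omega
    · omega
    · rw [hn] at hw
      obtain ⟨w, huw, hw⟩ := hw
      obtain ⟨x, hx, hxv⟩ := (aux_snoc G n w v).1 hw
      let e : G.line.V := ⟨(u, w), huw⟩
      let f : G.line.V := ⟨(x, v), hxv⟩
      have hef : G.line.Reachable e f := ⟨n + 1, (aux_line_walk G n e f).2 hx⟩
      have h1 := aux_le_innerDiam G.line hef
      have h2 := aux_dist_le G (aux_line_to G _ e f (aux_dist_walk G.line hef))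
      have h3 : G.dist u v ≤ G.line.dist e f + 1 := h2
      omega
  · refine aux_innerDiam_le G.line _ fun e f hr => ?_
    obtain ⟨k, hk⟩ := hr
    cases k with
    | zero =>
      have := aux_dist_le G.line hk
      omega
    | succ k =>
      have hr' : G.Reachable e.1.2 f.1.1 := ⟨k, (aux_line_walk G k e f).1 hk⟩
      have h1 := aux_le_innerDiam G hr'
      have h2 := aux_dist_le G.line ((aux_line_walk G _ e f).2 (aux_dist_walk G hr'))
      omega
end

section
/- For every pair of positive integers r₁, r₂, there exists a strongly connected digraph G such that the inner out-radius of G equals r₁ and the inner in-radius of G equals r₂. -/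
namespace Digraph'

theorem walk_append (G : Digraph') : ∀ (k l : ℕ) (u v w : G.V),
    G.HasWalk k u v → G.HasWalk l v w → G.HasWalk (k + l) u w
  | 0, l, u, v, w, h, h' => by
      have h : u = v := h
      subst h
      simpa using h'
  | k + 1, l, u, v, w, h, h' => by
      obtain ⟨z, hz, h⟩ := h
      rw [Nat.add_right_comm]
      exact ⟨z, hz, walk_append G k l z v w h h'⟩

theorem walk_one (G : Digraph') {u v : G.V} (h : G.Adj u v) : G.HasWalk 1 u v := ⟨v, h, rfl⟩

theorem walk_pot (G : Digraph') (f : G.V → ℤ) (hf : ∀ u v, G.Adj u v → f v ≤ f u + 1) :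
    ∀ (k : ℕ) (u v : G.V), G.HasWalk k u v → f v ≤ f u + k
  | 0, u, v, h => by
      have h : u = v := h
      subst h
      simp
  | k + 1, u, v, h => by
      obtain ⟨z, hz, h⟩ := h
      have h1 := walk_pot G f hf k z v h
      have h2 := hf u z hz
      push_cast
      linarith

theorem radiusOut_eq (G : Digraph') [Finite G.V] (hs : G.StronglyConnected) (r : ℕ) (c : G.V)
    (hc : ∀ v, ∃ k ≤ r, G.HasWalk k c v)
    (hl : ∀ u, ∃ v, ∀ k, G.HasWalk k u v → r ≤ k) : G.radiusOut = r := by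
  apply le_antisymm
  · have h0 : G.eccOut c ≤ r := by
      refine csSup_le ⟨_, c, hs c c, rfl⟩ ?_
      rintro n ⟨v, -, rfl⟩
      obtain ⟨k, hk, hw⟩ := hc v
      exact (Nat.sInf_le hw).trans hk
    exact le_trans (Nat.sInf_le (Set.mem_range_self c)) h0
  · refine le_csInf ⟨_, c, rfl⟩ ?_
    rintro n ⟨u, rfl⟩
    obtain ⟨v, hv⟩ := hl u
    have h1 : r ≤ G.dist u v := le_csInf (hs u v) hv
    refine h1.trans (le_csSup ?_ ⟨v, hs u v, rfl⟩)
    refine ((Set.finite_range (fun v => G.dist u v)).subset ?_).bddAbove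
    rintro n ⟨v, -, rfl⟩
    exact ⟨v, rfl⟩

theorem radiusIn_eq (G : Digraph') [Finite G.V] (hs : G.StronglyConnected) (r : ℕ) (c : G.V)
    (hc : ∀ v, ∃ k ≤ r, G.HasWalk k v c)
    (hl : ∀ u, ∃ v, ∀ k, G.HasWalk k v u → r ≤ k) : G.radiusIn = r := by
  apply le_antisymm
  · have h0 : G.eccIn c ≤ r := by
      refine csSup_le ⟨_, c, hs c c, rfl⟩ ?_
      rintro n ⟨v, -, rfl⟩
      obtain ⟨k, hk, hw⟩ := hc v
      exact (Nat.sInf_le hw).trans hk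
    exact le_trans (Nat.sInf_le (Set.mem_range_self c)) h0
  · refine le_csInf ⟨_, c, rfl⟩ ?_
    rintro n ⟨u, rfl⟩
    obtain ⟨v, hv⟩ := hl u
    have h1 : r ≤ G.dist v u := le_csInf (hs v u) hv
    refine h1.trans (le_csSup ?_ ⟨v, hs v u, rfl⟩)
    refine ((Set.finite_range (fun v => G.dist v u)).subset ?_).bddAbove
    rintro n ⟨v, -, rfl⟩
    exact ⟨v, rfl⟩

/-- A centre, two out-paths with `p` vertices, two in-paths with `q` vertices. -/
def spiderAdj (p q : ℕ) : Option (Bool × (Fin p ⊕ Fin q)) → Option (Bool × (Fin p ⊕ Fin q)) → Prop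
  | none, some (_, Sum.inl i) => i.val = 0
  | some (b, Sum.inl i), some (b', Sum.inl j) => b = b' ∧ j.val = i.val + 1
  | some (_, Sum.inl _), none => True
  | none, some (_, Sum.inr _) => True
  | some (_, Sum.inr i), none => i.val = 0
  | some (b, Sum.inr i), some (b', Sum.inr j) => b = b' ∧ i.val = j.val + 1
  | _, _ => False

/-- The spider digraph. -/
def spider (p q : ℕ) : Digraph' where
  V := Option (Bool × (Fin p ⊕ Fin q))
  Adj := spiderAdj p q

/-- Depth along the out-path `b`. -/
def potOut (p q : ℕ) (b : Bool) : Option (Bool × (Fin p ⊕ Fin q)) → ℤ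
  | some (b', Sum.inl i) => if b' = b then i.val + 1 else 0
  | _ => 0

/-- Minus the depth along the in-path `b`. -/
def potIn (p q : ℕ) (b : Bool) : Option (Bool × (Fin p ⊕ Fin q)) → ℤ
  | some (b', Sum.inr i) => if b' = b then -(i.val + 1) else 0
  | _ => 0

theorem potOut_lip (p q : ℕ) (b : Bool) (u v : (spider p q).V) (h : (spider p q).Adj u v) :
    potOut p q b v ≤ potOut p q b u + 1 := by
  change spiderAdj p q u v at h
  rcases u with _ | ⟨b1, i | i⟩ <;> rcases v with _ | ⟨b2, j | j⟩ <;>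
    simp only [spiderAdj, potOut] at h ⊢ <;> (try split_ifs) <;> grind

theorem potIn_lip (p q : ℕ) (b : Bool) (u v : (spider p q).V) (h : (spider p q).Adj u v) :
    potIn p q b v ≤ potIn p q b u + 1 := by
  change spiderAdj p q u v at h
  rcases u with _ | ⟨b1, i | i⟩ <;> rcases v with _ | ⟨b2, j | j⟩ <;>
    simp only [spiderAdj, potIn] at h ⊢ <;> (try split_ifs) <;> grind

theorem walk_out (p q : ℕ) (b : Bool) : ∀ (n : ℕ) (h : n < p),
    (spider p q).HasWalk (n + 1) (none : Option _) (some (b, Sum.inl ⟨n, h⟩) : Option _)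
  | 0, h => walk_one (spider p q) (show spiderAdj p q none (some (b, Sum.inl ⟨0, h⟩)) from rfl)
  | n + 1, h => walk_append _ _ 1 _ _ _ (walk_out p q b n (by omega))
      (walk_one (spider p q) (show spiderAdj p q (some (b, Sum.inl ⟨n, by omega⟩))
        (some (b, Sum.inl ⟨n + 1, h⟩)) from ⟨rfl, rfl⟩))

theorem walk_in (p q : ℕ) (b : Bool) : ∀ (n : ℕ) (h : n < q),
    (spider p q).HasWalk (n + 1) (some (b, Sum.inr ⟨n, h⟩) : Option _) (none : Option _)
  | 0, h => walk_one (spider p q) (show spiderAdj p q (some (b, Sum.inr ⟨0, h⟩)) none from rfl)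
  | n + 1, h => ⟨(some (b, Sum.inr ⟨n, by omega⟩) : Option _), ⟨rfl, rfl⟩,
      walk_in p q b n (by omega)⟩

end Digraph'

open Digraph' in
/-- For every pair of positive integers `r₁, r₂` there exists a
strongly connected digraph with inner out-radius `r₁` and inner in-radius `r₂`. -/
theorem stmt_6 (r₁ r₂ : ℕ) (h1 : 0 < r₁) (h2 : 0 < r₂) :
    ∃ G : Digraph', Finite G.V ∧ G.StronglyConnected ∧
      G.radiusOut = r₁ ∧ G.radiusIn = r₂ := by
  have hout : ∀ v : (spider r₁ r₂).V, ∃ k ≤ r₁, (spider r₁ r₂).HasWalk k (none : Option _) v := by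
    rintro (_ | ⟨b, i | i⟩)
    · exact ⟨0, by omega, rfl⟩
    · exact ⟨i.val + 1, i.isLt, walk_out r₁ r₂ b i.val i.isLt⟩
    · exact ⟨1, h1, walk_one (spider r₁ r₂) trivial⟩
  have hin : ∀ v : (spider r₁ r₂).V, ∃ k ≤ r₂, (spider r₁ r₂).HasWalk k v (none : Option _) := by
    rintro (_ | ⟨b, i | i⟩)
    · exact ⟨0, by omega, rfl⟩
    · exact ⟨1, h2, walk_one (spider r₁ r₂) trivial⟩
    · exact ⟨i.val + 1, i.isLt, walk_in r₁ r₂ b i.val i.isLt⟩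
  have hfin : Finite (spider r₁ r₂).V :=
    inferInstanceAs (Finite (Option (Bool × (Fin r₁ ⊕ Fin r₂))))
  have hs : (spider r₁ r₂).StronglyConnected := by
    intro u v
    obtain ⟨k, -, hk⟩ := hin u
    obtain ⟨l, -, hl⟩ := hout v
    exact ⟨k + l, walk_append _ _ _ _ _ _ hk hl⟩
  refine ⟨spider r₁ r₂, hfin, hs, radiusOut_eq _ hs r₁ _ hout ?_, radiusIn_eq _ hs r₂ _ hin ?_⟩
  · intro u
    have hb : ∃ b, potOut r₁ r₂ b u = 0 := by
      rcases u with _ | ⟨b, i | i⟩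
      · exact ⟨true, rfl⟩
      · exact ⟨!b, by simp [potOut]⟩
      · exact ⟨true, rfl⟩
    obtain ⟨b, hb⟩ := hb
    refine ⟨(some (b, Sum.inl ⟨r₁ - 1, by omega⟩) : Option _), fun k hk => ?_⟩
    have := walk_pot _ (potOut r₁ r₂ b) (potOut_lip r₁ r₂ b) k _ _ hk
    rw [hb] at this
    simp only [potOut, if_true] at this
    omega
  · intro u
    have hb : ∃ b, potIn r₁ r₂ b u = 0 := by
      rcases u with _ | ⟨b, i | i⟩
      · exact ⟨true, rfl⟩
      · exact ⟨true, rfl⟩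
      · exact ⟨!b, by simp [potIn]⟩
    obtain ⟨b, hb⟩ := hb
    refine ⟨(some (b, Sum.inr ⟨r₂ - 1, by omega⟩) : Option _), fun k hk => ?_⟩
    have := walk_pot _ (potIn r₁ r₂ b) (potIn_lip r₁ r₂ b) k _ _ hk
    rw [hb] at this
    simp only [potIn, if_true] at this
    omega
end

section
/- Let G be a non-strongly-connected digraph whose only non-trivial strongly connected subdigraph is a directed cycle (that is, G contains exactly one directed cycle). Then the sequence d(G), d(LG), d(L²G), … of inner diameters of the iterated line digraphs of G is eventually periodic: there exist integers m ≥ 0 and p > 0 such that d(L^{k+p}G) = d(L^kG) for all k ≥ m. -/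
/-- A directed cycle in `G` on `n ≥ 1` vertices: an injective map from `ZMod n`
such that consecutive images are adjacent. -/
def Digraph'.IsCycleIn (G : Digraph') (n : ℕ) (c : ZMod n → G.V) : Prop :=
  1 ≤ n ∧ Function.Injective c ∧ ∀ i : ZMod n, G.Adj (c i) (c (i + 1))

namespace Digraph'

/-- the first `m+1` values of `w` form a walk -/
def IsW (G : Digraph') (m : ℕ) (w : ℕ → G.V) : Prop := ∀ i, i < m → G.Adj (w i) (w (i + 1))

/-- the function `w` represents the vertex `x` of the iterated line digraph -/
def Rep (G : Digraph') : (k : ℕ) → (G.iterLine k).V → (ℕ → G.V) → Prop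
  | 0, x, w => w 0 = x
  | (k + 1), x, w => Rep G k x.val.1 w ∧ Rep G k x.val.2 (fun i => w (i + 1))

theorem Rep.congr {G : Digraph'} : ∀ {k : ℕ} {x : (G.iterLine k).V} {w w' : ℕ → G.V},
    G.Rep k x w → (∀ i, i ≤ k → w i = w' i) → G.Rep k x w' := by
  intro k
  induction k with
  | zero => intro x w w' h hw; exact (hw 0 le_rfl).symm.trans h
  | succ k ih =>
    intro x w w' h hw
    exact ⟨ih h.1 (fun i hi => hw i (by omega)), ih h.2 (fun i hi => hw (i + 1) (by omega))⟩

theorem Rep.unique {G : Digraph'} : ∀ {k : ℕ} {x y : (G.iterLine k).V} {w : ℕ → G.V},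
    G.Rep k x w → G.Rep k y w → x = y := by
  intro k
  induction k with
  | zero => intro x y w h h'; exact h.symm.trans h'
  | succ k ih =>
    intro x y w h h'
    exact Subtype.ext (Prod.ext (ih h.1 h'.1) (ih h.2 h'.2))

theorem Rep.agree {G : Digraph'} : ∀ {k : ℕ} {x : (G.iterLine k).V} {w w' : ℕ → G.V},
    G.Rep k x w → G.Rep k x w' → ∀ i, i ≤ k → w i = w' i := by
  intro k
  induction k with
  | zero =>
    intro x w w' h h' i hi
    obtain rfl : i = 0 := by omega
    exact Eq.trans h (Eq.symm h')
  | succ k ih =>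
    intro x w w' h h' i hi
    rcases i with _ | i
    · exact ih h.1 h'.1 0 (by omega)
    · exact ih h.2 h'.2 i (by omega)

theorem Rep.isW {G : Digraph'} : ∀ {k : ℕ} {x : (G.iterLine k).V} {w : ℕ → G.V},
    G.Rep k x w → G.IsW k w := by
  intro k
  induction k with
  | zero => intro x w h i hi; omega
  | succ k ih =>
    intro x w h i hi
    rcases i with _ | i
    · rcases k with _ | k
      · have h1 : w 0 = x.val.1 := h.1
        have h2 : w 1 = x.val.2 := h.2
        have h3 : G.Adj x.val.1 x.val.2 := x.property
        rw [← h1, ← h2] at h3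
        exact h3
      · exact ih h.1 0 (by omega)
    · exact ih h.2 i (by omega)

theorem adj_of_rep {G : Digraph'} {k : ℕ} {a b : (G.iterLine k).V} {w : ℕ → G.V}
    (ha : G.Rep k a w) (hb : G.Rep k b (fun i => w (i + 1))) (hw : G.IsW (k + 1) w) :
    (G.iterLine k).Adj a b := by
  rcases k with _ | k
  · have h1 : w 0 = a := ha
    have h2 : w 1 = b := hb
    have h3 := hw 0 (by omega)
    rw [h1] at h3
    change G.Adj a (w 1) at h3
    rw [h2] at h3
    exact h3
  · exact Rep.unique ha.2 hb.1

theorem exists_of_isW {G : Digraph'} : ∀ {k : ℕ} {w : ℕ → G.V}, G.IsW k w →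
    ∃ x, G.Rep k x w := by
  intro k
  induction k with
  | zero => intro w _; exact ⟨w 0, rfl⟩
  | succ k ih =>
    intro w hw
    obtain ⟨a, ha⟩ := ih (w := w) (fun i hi => hw i (by omega))
    obtain ⟨b, hb⟩ := ih (w := fun i => w (i + 1)) (fun i hi => hw (i + 1) (by omega))
    exact ⟨⟨(a, b), adj_of_rep ha hb hw⟩, ha, hb⟩

/-- prepend a value to a sequence -/
def pre {α : Type} (a : α) (w : ℕ → α) : ℕ → α
  | 0 => a
  | (i + 1) => w i

theorem exists_rep {G : Digraph'} : ∀ {k : ℕ} (x : (G.iterLine k).V), ∃ w, G.Rep k x w := by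
  intro k
  induction k with
  | zero => intro x; exact ⟨fun _ => x, rfl⟩
  | succ k ih =>
    intro x
    obtain ⟨w, hw⟩ := ih x.val.1
    obtain ⟨w', hw'⟩ := ih x.val.2
    refine ⟨pre (w 0) w', ?_, hw'⟩
    refine hw.congr ?_
    intro i hi
    rcases i with _ | i
    · rfl
    · rcases k with _ | k
      · omega
      · have hx : x.val.1.val.2 = x.val.2.val.1 := x.property
        have h1 := hw.2
        rw [hx] at h1
        exact Rep.agree h1 hw'.1 i (by omega)

theorem hasWalk_iff {G : Digraph'} {k : ℕ} : ∀ {j : ℕ} {x y : (G.iterLine k).V},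
    (G.iterLine k).HasWalk j x y ↔
      ∃ W, G.IsW (k + j) W ∧ G.Rep k x W ∧ G.Rep k y (fun i => W (i + j)) := by
  intro j
  induction j with
  | zero =>
    intro x y
    constructor
    · intro h
      have h : x = y := h
      subst h
      obtain ⟨w, hw⟩ := exists_rep x
      exact ⟨w, hw.isW, hw, hw⟩
    · rintro ⟨W, _, h1, h2⟩
      exact Rep.unique h1 h2
  | succ j ih =>
    intro x y
    constructor
    · rintro ⟨z, hxz, hzy⟩
      obtain ⟨W, hW, hz, hy⟩ := ih.1 hzy
      obtain ⟨w, hw⟩ := exists_rep (G := G) (k := k + 1) ⟨(x, z), hxz⟩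
      have hag : ∀ i, i ≤ k + 1 → w i = pre (w 0) W i := by
        intro i hi
        rcases i with _ | i
        · rfl
        · exact Rep.agree hw.2 hz i (by omega)
      refine ⟨pre (w 0) W, ?_, hw.1.congr (fun i hi => hag i (by omega)), hy⟩
      intro i hi
      rcases i with _ | i
      · rw [← hag 0 (by omega), ← hag (0 + 1) (by omega)]
        exact hw.isW 0 (by omega)
      · exact hW i (by omega)
    · rintro ⟨W, hW, hx, hy⟩
      obtain ⟨z, hz⟩ := exists_of_isW (G := G) (k := k) (w := fun i => W (i + 1))
        (fun i hi => hW (i + 1) (by omega))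
      refine ⟨z, adj_of_rep hx hz (fun i hi => hW i (by omega)), ih.2 ⟨fun i => W (i + 1),
        fun i hi => hW (i + 1) (by omega), hz, ?_⟩⟩
      exact hy

/-- the set of finite distances in `L^k G` -/
def DS (G : Digraph') (k : ℕ) : Set ℕ :=
  {n | ∃ u v : (G.iterLine k).V, (G.iterLine k).Reachable u v ∧ (G.iterLine k).dist u v = n}

theorem mem_DS {G : Digraph'} {k j : ℕ} : j ∈ G.DS k ↔
    ∃ W, G.IsW (k + j) W ∧ ∀ j', j' < j → ¬ ∃ W', G.IsW (k + j') W' ∧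
      (∀ i, i ≤ k → W' i = W i) ∧ (∀ i, i ≤ k → W' (i + j') = W (i + j)) := by
  constructor
  · rintro ⟨x, y, hr, hd⟩
    have hmem : (G.iterLine k).HasWalk j x y := by rw [← hd]; exact Nat.sInf_mem hr
    obtain ⟨W, hW, hx, hy⟩ := hasWalk_iff.1 hmem
    refine ⟨W, hW, ?_⟩
    rintro j' hj' ⟨W', hW', h1, h2⟩
    have : (G.iterLine k).HasWalk j' x y := hasWalk_iff.2 ⟨W', hW',
      hx.congr (fun i hi => (h1 i hi).symm), hy.congr (fun i hi => (h2 i hi).symm)⟩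
    have := Nat.sInf_le (s := {m | (G.iterLine k).HasWalk m x y}) this
    unfold dist at hd
    omega
  · rintro ⟨W, hW, hmin⟩
    obtain ⟨x, hx⟩ := exists_of_isW (G := G) (k := k) (w := W) (fun i hi => hW i (by omega))
    obtain ⟨y, hy⟩ := exists_of_isW (G := G) (k := k) (w := fun i => W (i + j))
      (fun i hi => by
        have := hW (i + j) (by omega)
        rwa [Nat.add_right_comm] at this)
    have hxy : (G.iterLine k).HasWalk j x y := hasWalk_iff.2 ⟨W, hW, hx, hy⟩
    refine ⟨x, y, ⟨j, hxy⟩, le_antisymm (Nat.sInf_le hxy) ?_⟩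
    by_contra hlt
    push Not at hlt
    have hm : (G.iterLine k).HasWalk ((G.iterLine k).dist x y) x y :=
      Nat.sInf_mem (s := {m | (G.iterLine k).HasWalk m x y}) ⟨j, hxy⟩
    obtain ⟨W', hW', hx', hy'⟩ := hasWalk_iff.1 hm
    exact hmin _ hlt ⟨W', hW', fun i hi => Rep.agree hx' hx i hi,
      fun i hi => Rep.agree hy' hy i hi⟩

theorem mem_DS' {G : Digraph'} {k j : ℕ} (hjk : j ≤ k) : j ∈ G.DS k ↔
    ∃ W, G.IsW (k + j) W ∧ ∀ j', j' < j → ∃ i, i + j' ≤ k ∧ W (i + j') ≠ W (i + j) := by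
  rw [mem_DS]
  refine exists_congr fun W => and_congr_right fun hW => forall₂_congr fun j' hj' => ?_
  constructor
  · intro h
    by_contra hcon
    push Not at hcon
    refine h ⟨fun s => if s ≤ k then W s else W (s + (j - j')), ?_, ?_, ?_⟩
    · intro i hi
      dsimp only
      by_cases h1 : i + 1 ≤ k
      · rw [if_pos h1, if_pos (by omega)]; exact hW i (by omega)
      · rw [if_neg h1]
        have h3 := hW (i + (j - j')) (by omega)
        rw [Nat.add_right_comm] at h3
        by_cases h2 : i ≤ k
        · obtain rfl : i = k := by omega
          rw [if_pos h2]
          have h4 := hcon (i - j') (by omega)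
          rw [show i - j' + j' = i by omega, show i - j' + j = i + (j - j') by omega] at h4
          rw [h4]; exact h3
        · rw [if_neg h2]; exact h3
    · intro i hi; exact if_pos hi
    · intro i hi
      dsimp only
      by_cases h1 : i + j' ≤ k
      · rw [if_pos h1]; exact hcon i h1
      · rw [if_neg h1]; congr 1; omega
  · rintro ⟨i, hi, hne⟩ ⟨W', _, h1, h2⟩
    exact hne ((h1 _ hi).symm.trans (h2 i (by omega)))

/-- closed walks through `v` give cycles through `v` -/
theorem cycle_of_closed {G : Digraph'} {v : G.V} {m : ℕ} (hm : 1 ≤ m) {w : ℕ → G.V}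
    (hw : G.IsW m w) (h0 : w 0 = v) (h1 : w m = v) :
    ∃ (m' : ℕ) (c : ZMod m' → G.V), m' ≤ m ∧ G.IsCycleIn m' c ∧ v ∈ Set.range c := by
  classical
  have hex : ∃ m, 1 ≤ m ∧ ∃ w, G.IsW m w ∧ w 0 = v ∧ w m = v := ⟨m, hm, w, hw, h0, h1⟩
  obtain ⟨hl1, u, hu, hu0, hul⟩ := Nat.find_spec hex
  have hmin := fun t => Nat.find_min' hex (m := t)
  have hle := hmin m ⟨hm, w, hw, h0, h1⟩
  generalize Nat.find hex = l at *
  have hinj : ∀ a b, a < b → b < l → u a ≠ u b := by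
    intro a b hab hbl he
    have := hmin (l - (b - a)) ⟨by omega, fun s => if s ≤ a then u s else u (s + (b - a)), ?_,
      by simpa using hu0, ?_⟩
    · omega
    · intro i hi
      dsimp only
      have h3 := hu (i + (b - a)) (by omega)
      rw [Nat.add_right_comm] at h3
      by_cases h1 : i + 1 ≤ a
      · rw [if_pos h1, if_pos (by omega)]; exact hu i (by omega)
      · rw [if_neg h1]
        by_cases h2 : i ≤ a
        · obtain rfl : i = a := by omega
          rw [if_pos h2, he]
          rw [show i + (b - i) = b by omega] at h3
          exact h3
        · rw [if_neg h2]; exact h3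
    · dsimp only
      rw [if_neg (by omega), ← hul]
      congr 1; omega
  haveI : NeZero l := ⟨by omega⟩
  refine ⟨l, fun i => u i.val, hle, ⟨hl1, ?_, ?_⟩, ⟨0, ?_⟩⟩
  · intro i j hij
    have hi := ZMod.val_lt i
    have hj := ZMod.val_lt j
    apply ZMod.val_injective l
    rcases lt_trichotomy i.val j.val with h | h | h
    · exact absurd hij (hinj _ _ h hj)
    · exact h
    · exact absurd hij.symm (hinj _ _ h hi)
  · intro i
    have hi := ZMod.val_lt i
    have hv : (i + 1).val = (i.val + 1) % l := by
      rw [ZMod.val_add, ZMod.val_one_eq_one_mod]; simp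
    dsimp only
    rw [hv]
    have h3 := hu i.val hi
    by_cases h : i.val + 1 < l
    · rw [Nat.mod_eq_of_lt h]; exact h3
    · have : i.val + 1 = l := by omega
      rw [this] at h3 ⊢
      rw [Nat.mod_self, hu0, ← hul]; exact h3
  · dsimp only; rw [ZMod.val_zero]; exact hu0

theorem transGen_walk {G : Digraph'} {u v : G.V} (h : Relation.TransGen G.Adj u v) :
    ∃ m w, 1 ≤ m ∧ G.IsW m w ∧ w 0 = u ∧ w m = v := by
  induction h using Relation.TransGen.head_induction_on with
  | single h => 
    refine ⟨1, pre _ (fun _ => v), le_rfl, ?_, rfl, rfl⟩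
    intro i hi
    obtain rfl : i = 0 := by omega
    exact h
  | head h _ ih =>
    obtain ⟨m, w, hm, hw, h0, h1⟩ := ih
    refine ⟨m + 1, pre _ w, by omega, ?_, rfl, h1⟩
    intro i hi
    rcases i with _ | i
    · change G.Adj _ (w 0)
      rw [h0]; exact h
    · exact hw i (by omega)

theorem IsW.transGen {G : Digraph'} {l : ℕ} {w : ℕ → G.V} (hw : G.IsW l w) {i j : ℕ}
    (hij : i < j) (hj : j ≤ l) : Relation.TransGen G.Adj (w i) (w j) := by
  induction j, hij using Nat.le_induction with
  | base => exact .single (hw i (by omega))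
  | succ j hij ih => exact (ih (by omega)).tail (hw j (by omega))

section core

variable {G : Digraph'} {n : ℕ} {c : ZMod n → G.V}

theorem cyc_trans (hc : G.IsCycleIn n c) (p q : ZMod n) : 
    Relation.TransGen G.Adj (c p) (c q) := by
  haveI : NeZero n := ⟨by have := hc.1; omega⟩
  have key : ∀ s : ℕ, Relation.TransGen G.Adj (c p) (c (p + s + 1)) := by
    intro s
    induction s with
    | zero => simpa using Relation.TransGen.single (hc.2.2 p)
    | succ s ih =>
      have := ih.tail (hc.2.2 _)
      push_cast
      rwa [← add_assoc]
  have := key (q - p - 1).val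
  rw [ZMod.natCast_zmod_val] at this
  convert this using 2
  ring

theorem mem_cyc (hc : G.IsCycleIn n c)
    (hu : ∀ (n' : ℕ) (c' : ZMod n' → G.V), G.IsCycleIn n' c' → n' = n ∧ Set.range c' = Set.range c)
    {v : G.V} (h : Relation.TransGen G.Adj v v) : ∃ a, c a = v := by
  obtain ⟨m, w, hm, hw, h0, h1⟩ := transGen_walk h
  obtain ⟨m', c', _, hc', hv⟩ := cycle_of_closed hm hw h0 h1
  rw [(hu m' c' hc').2] at hv
  exact hv

theorem cyc_succ (hc : G.IsCycleIn n c)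
    (hu : ∀ (n' : ℕ) (c' : ZMod n' → G.V), G.IsCycleIn n' c' → n' = n ∧ Set.range c' = Set.range c)
    {a b : ZMod n} (h : G.Adj (c a) (c b)) : b = a + 1 := by
  haveI : NeZero n := ⟨by have := hc.1; omega⟩
  obtain ⟨m', c', hle, hc', _⟩ := cycle_of_closed (G := G) (v := c a) (m := (a - b).val + 1)
    (w := pre (c a) (fun s => c (b + s))) (by omega) (by
      intro i hi
      rcases i with _ | i
      · simpa [pre] using h
      · have := hc.2.2 (b + i)
        simp only [pre]
        push_cast
        rwa [← add_assoc]) rfl (by simp [pre])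
  have h1 := (hu m' c' hc').1
  have h2 := ZMod.val_lt (a - b)
  have h3 : (((a - b).val + 1 : ℕ) : ZMod n) = 0 := by
    rw [show (a - b).val + 1 = n by omega]; simp
  push_cast at h3
  rw [ZMod.natCast_zmod_val] at h3
  linear_combination -h3

theorem pigeon [Finite G.V] (f : ℕ → G.V) : ∃ a b, a < b ∧ b ≤ Nat.card G.V ∧ f a = f b := by
  haveI := Fintype.ofFinite G.V
  obtain ⟨x, y, hne, he⟩ := Fintype.exists_ne_map_eq_of_card_lt
    (fun i : Fin (Nat.card G.V + 1) => f i) (by simp [Nat.card_eq_fintype_card])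
  have hx := x.isLt
  have hy := y.isLt
  have : x.val ≠ y.val := fun h => hne (Fin.ext h)
  rcases lt_or_gt_of_ne this with h | h
  · exact ⟨x, y, h, by omega, he⟩
  · exact ⟨y, x, h, by omega, he.symm⟩

theorem middle_mem [Finite G.V] (hc : G.IsCycleIn n c)
    (hu : ∀ (n' : ℕ) (c' : ZMod n' → G.V), G.IsCycleIn n' c' → n' = n ∧ Set.range c' = Set.range c)
    {l : ℕ} {W : ℕ → G.V} (hW : G.IsW l W) {i : ℕ} (h1 : Nat.card G.V ≤ i)
    (h2 : i + Nat.card G.V ≤ l) : ∃ a, c a = W i := by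
  obtain ⟨a, b, hab, hb, he⟩ := pigeon W
  obtain ⟨a', b', hab', hb', he'⟩ := pigeon (fun s => W (i + s))
  have t1 := hW.transGen hab (by omega)
  have t2 := hW.transGen (show i + a' < i + b' by omega) (by omega)
  rw [← he] at t1
  change W (i + a') = W (i + b') at he'
  rw [← he'] at t2
  obtain ⟨p, hp⟩ := mem_cyc hc hu t1
  obtain ⟨q, hq⟩ := mem_cyc hc hu t2
  have t3 := cyc_trans hc q p
  rw [hp, hq] at t3
  refine mem_cyc hc hu ?_
  have t4 : Relation.TransGen G.Adj (W a) (W i) := hW.transGen (by omega) (by omega)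
  have t5 : Relation.ReflTransGen G.Adj (W i) (W (i + a')) := by
    rcases Nat.eq_zero_or_pos a' with h | h
    · subst h; exact .refl
    · exact (hW.transGen (by omega) (by omega)).to_reflTransGen
  exact Relation.TransGen.trans_right t5 (t3.trans t4)

theorem middle_per [Finite G.V] (hc : G.IsCycleIn n c)
    (hu : ∀ (n' : ℕ) (c' : ZMod n' → G.V), G.IsCycleIn n' c' → n' = n ∧ Set.range c' = Set.range c)
    {l : ℕ} {W : ℕ → G.V} (hW : G.IsW l W) {i : ℕ} (h1 : Nat.card G.V ≤ i)
    (h2 : i + n + Nat.card G.V ≤ l) : W (i + n) = W i := by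
  obtain ⟨a, ha⟩ := middle_mem hc hu hW h1 (by omega)
  have key : ∀ t : ℕ, t ≤ n → W (i + t) = c (a + t) := by
    intro t
    induction t with
    | zero => intro _; simp [ha]
    | succ t ih =>
      intro ht
      obtain ⟨b, hb⟩ := middle_mem hc hu hW (i := i + t + 1) (by omega) (by omega)
      have h3 := hW (i + t) (by omega)
      rw [ih (by omega), ← hb] at h3
      have h4 := cyc_succ hc hu h3
      rw [← add_assoc, ← hb, h4]
      push_cast
      rw [add_assoc]
  rw [key n le_rfl, ← ha]
  simp

theorem DS_lt [Finite G.V] (hc : G.IsCycleIn n c)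
    (hu : ∀ (n' : ℕ) (c' : ZMod n' → G.V), G.IsCycleIn n' c' → n' = n ∧ Set.range c' = Set.range c)
    {k j : ℕ} (hk : Nat.card G.V ≤ k) (hj : j ∈ G.DS k) : j < Nat.card G.V + n := by
  obtain ⟨W, hW, hmin⟩ := mem_DS.1 hj
  have hn := hc.1
  by_contra hcon
  push Not at hcon
  have per := fun i => middle_per hc hu hW (i := i)
  generalize Nat.card G.V = N at *
  refine hmin (j - n) (by omega) ⟨fun s => if s ≤ N then W s else W (s + n), ?_, ?_, ?_⟩
  · intro i hi
    dsimp only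
    have h3 := hW (i + n) (by omega)
    rw [Nat.add_right_comm] at h3
    by_cases h1 : i + 1 ≤ N
    · rw [if_pos h1, if_pos (by omega)]; exact hW i (by omega)
    · rw [if_neg h1]
      by_cases h2 : i ≤ N
      · rw [if_pos h2, ← per i (by omega) (by omega)]; exact h3
      · rw [if_neg h2]; exact h3
  · intro i hi
    dsimp only
    split_ifs with h
    · rfl
    · exact per i (by omega) (by omega)
  · intro i hi
    dsimp only
    split_ifs with h
    · rw [← per _ (by omega) (by omega)]; congr 1; omega
    · congr 1; omega

theorem DS_per [Finite G.V] (hc : G.IsCycleIn n c)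
    (hu : ∀ (n' : ℕ) (c' : ZMod n' → G.V), G.IsCycleIn n' c' → n' = n ∧ Set.range c' = Set.range c)
    {k j : ℕ} (hk : 4 * (Nat.card G.V + n) ≤ k) (hj : j < Nat.card G.V + n) :
    j ∈ G.DS (k + n) ↔ j ∈ G.DS k := by
  have hn := hc.1
  rw [mem_DS' (by omega), mem_DS' (by omega)]
  have per := fun l W hW i => middle_per hc hu (l := l) (W := W) hW (i := i)
  generalize Nat.card G.V = N at *
  constructor
  · rintro ⟨W, hW, h⟩
    have per := per _ W hW
    have e1 : ∀ s, s + N ≤ k + j → (if s ≤ N then W s else W (s + n)) = W s := by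
      intro s hs
      split_ifs with h
      · rfl
      · exact per s (by omega) (by omega)
    have e2 : ∀ s, N ≤ s → (if s ≤ N then W s else W (s + n)) = W (s + n) := by
      intro s hs
      split_ifs with h
      · exact (per s (by omega) (by omega)).symm
      · rfl
    refine ⟨fun s => if s ≤ N then W s else W (s + n), ?_, ?_⟩
    · intro i hi
      dsimp only
      by_cases h1 : N ≤ i
      · rw [e2 i h1, e2 (i + 1) (by omega), Nat.add_right_comm]
        exact hW _ (by omega)
      · rw [e1 i (by omega), e1 (i + 1) (by omega)]
        exact hW _ (by omega)
    · intro j' hj'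
      obtain ⟨i, hi, hne⟩ := h j' hj'
      dsimp only
      by_cases h1 : N + n ≤ i
      · refine ⟨i - n, by omega, ?_⟩
        rw [e2 _ (by omega), e2 _ (by omega), show i - n + j' + n = i + j' by omega,
          show i - n + j + n = i + j by omega]
        exact hne
      · refine ⟨i, by omega, ?_⟩
        rw [e1 _ (by omega), e1 _ (by omega)]
        exact hne
  · rintro ⟨W, hW, h⟩
    have per := per _ W hW
    have e1 : ∀ s, s + N ≤ k + j → (if s ≤ N + n then W s else W (s - n)) = W s := by
      intro s hs
      split_ifs with h
      · rfl
      · rw [← per (s - n) (by omega) (by omega)]; congr 1; omega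
    have e2 : ∀ s, N ≤ s → (if s + n ≤ N + n then W (s + n) else W (s + n - n)) = W s := by
      intro s hs
      split_ifs with h
      · exact per s (by omega) (by omega)
      · congr 1; omega
    refine ⟨fun s => if s ≤ N + n then W s else W (s - n), ?_, ?_⟩
    · intro i hi
      dsimp only
      by_cases h1 : N + n ≤ i
      · obtain ⟨t, rfl⟩ : ∃ t, i = t + n := ⟨i - n, by omega⟩
        rw [Nat.add_right_comm, e2 t (by omega), e2 (t + 1) (by omega)]
        exact hW _ (by omega)
      · rw [e1 i (by omega), e1 (i + 1) (by omega)]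
        exact hW _ (by omega)
    · intro j' hj'
      obtain ⟨i, hi, hne⟩ := h j' hj'
      dsimp only
      by_cases h1 : i + N ≤ k
      · refine ⟨i, by omega, ?_⟩
        rw [e1 _ (by omega), e1 _ (by omega)]
        exact hne
      · refine ⟨i + n, by omega, ?_⟩
        rw [Nat.add_right_comm, Nat.add_right_comm i n j, e2 _ (by omega), e2 _ (by omega)]
        exact hne

end core

end Digraph'

/-- If `G` is not strongly connected and contains exactly one
directed cycle, then the sequence of inner diameters of its iterated line
digraphs is eventually periodic. -/
theorem stmt_8 (G : Digraph') [Finite G.V] (hnsc : ¬ G.StronglyConnected)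
    (hex : ∃ (n : ℕ) (c : ZMod n → G.V), G.IsCycleIn n c)
    (huniq : ∀ (n : ℕ) (c : ZMod n → G.V) (n' : ℕ) (c' : ZMod n' → G.V),
      G.IsCycleIn n c → G.IsCycleIn n' c' → n = n' ∧ Set.range c = Set.range c') :
    ∃ (m p : ℕ), 0 < p ∧ ∀ k : ℕ, m ≤ k →
      (G.iterLine (k + p)).innerDiam = (G.iterLine k).innerDiam := by
  obtain ⟨n, c, hc⟩ := hex
  have hu : ∀ (n' : ℕ) (c' : ZMod n' → G.V), G.IsCycleIn n' c' →
      n' = n ∧ Set.range c' = Set.range c := fun n' c' hc' => huniq n' c' n c hc' hc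
  refine ⟨4 * (Nat.card G.V + n), n, hc.1, fun k hk => ?_⟩
  have hs : G.DS (k + n) = G.DS k := by
    ext j
    constructor
    · intro h
      exact (Digraph'.DS_per hc hu hk (Digraph'.DS_lt hc hu (by omega) h)).1 h
    · intro h
      exact (Digraph'.DS_per hc hu hk (Digraph'.DS_lt hc hu (by omega) h)).2 h
  exact congrArg sSup hs
end

section
/- Let G be a digraph that contains a strongly connected subdigraph G′ (with at least one arc) which is not a directed cycle. Then the sequence d(G), d(LG), d(L²G), … of inner diameters of the iterated line digraphs of G tends to infinity. -/
namespace Digraph'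

/-- every vertex has at most `D` out-neighbours -/
def OutBdd (G : Digraph') (D : ℕ) : Prop :=
  ∀ u : G.V, ∃ T : Finset G.V, T.card ≤ D ∧ ∀ v, G.Adj u v → v ∈ T

/-- Invariant used for the strongly connected subdigraph. -/
structure Good (H : Digraph') : Prop where
  sc : H.StronglyConnected
  out : ∀ u : H.V, ∃ v, H.Adj u v
  inn : ∀ v : H.V, ∃ u, H.Adj u v
  br : ∃ u v w : H.V, H.Adj u v ∧ H.Adj u w ∧ v ≠ w

theorem finite_line (G : Digraph') [Finite G.V] : Finite G.line.V :=
  inferInstanceAs (Finite {p : G.V × G.V // G.Adj p.1 p.2})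

theorem finite_iterLine (G : Digraph') [Finite G.V] (k : ℕ) : Finite (G.iterLine k).V := by
  induction k with
  | zero => exact (inferInstance : Finite G.V)
  | succ k ih => exact finite_line _

theorem OutBdd.line {G : Digraph'} {D : ℕ} (h : G.OutBdd D) : G.line.OutBdd D := by
  classical
  intro e
  obtain ⟨T, hT, hm⟩ := h e.val.2
  let g : G.V → G.line.V := fun w =>
    if hw : G.Adj e.val.2 w then ⟨(e.val.2, w), hw⟩ else e
  refine ⟨T.image g, Finset.card_image_le.trans hT, ?_⟩
  rintro ⟨⟨a, b⟩, hab⟩ hv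
  have hv' : e.val.2 = a := hv
  subst hv'
  exact Finset.mem_image.2 ⟨b, hm _ hab, dif_pos hab⟩

theorem OutBdd.iterLine {G : Digraph'} {D : ℕ} (h : G.OutBdd D) (k : ℕ) :
    (G.iterLine k).OutBdd D := by
  induction k with
  | zero => exact h
  | succ k ih => exact ih.line

theorem OutBdd.walk {G : Digraph'} {D : ℕ} (h : G.OutBdd D) (k : ℕ) :
    ∀ u : G.V, ∃ T : Finset G.V, T.card ≤ D ^ k ∧ ∀ v, G.HasWalk k u v → v ∈ T := by
  classical
  induction k with
  | zero =>
    intro u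
    refine ⟨{u}, by simp, ?_⟩
    intro v hv
    have : u = v := hv
    simp [this]
  | succ k ih =>
    intro u
    choose S hS hSm using ih
    obtain ⟨T, hT, hm⟩ := h u
    refine ⟨T.biUnion S, ?_, ?_⟩
    · calc (T.biUnion S).card ≤ T.card * D ^ k :=
            Finset.card_biUnion_le_card_mul _ _ _ (fun a _ => hS a)
        _ ≤ D * D ^ k := Nat.mul_le_mul_right _ hT
        _ = D ^ (k + 1) := by ring
    · rintro v ⟨w, hw, hwv⟩
      exact Finset.mem_biUnion.2 ⟨w, hm _ hw, hSm _ _ hwv⟩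

theorem line_hasWalk {G : Digraph'} (k : ℕ) : ∀ (e f : G.line.V),
    G.HasWalk k e.val.2 f.val.1 → G.line.HasWalk (k + 1) e f := by
  induction k with
  | zero => intro e f h; exact ⟨f, h, rfl⟩
  | succ k ih =>
    rintro e f ⟨w, hw, hwf⟩
    exact ⟨⟨(e.val.2, w), hw⟩, rfl, ih _ _ hwf⟩

theorem Good.line {H : Digraph'} (h : H.Good) : H.line.Good where
  sc e f := by
    obtain ⟨k, hk⟩ := h.sc e.val.2 f.val.1
    exact ⟨k + 1, line_hasWalk k e f hk⟩
  out e := by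
    obtain ⟨w, hw⟩ := h.out e.val.2
    exact ⟨⟨(_, w), hw⟩, rfl⟩
  inn e := by
    obtain ⟨w, hw⟩ := h.inn e.val.1
    exact ⟨⟨(w, _), hw⟩, rfl⟩
  br := by
    obtain ⟨u, v, w, hv, hw, hne⟩ := h.br
    obtain ⟨x, hx⟩ := h.inn u
    refine ⟨⟨(x, u), hx⟩, ⟨(u, v), hv⟩, ⟨(u, w), hw⟩, rfl, rfl, ?_⟩
    intro h
    exact hne (congrArg (fun e : H.line.V => e.val.2) h)

theorem Good.iterLine {H : Digraph'} (h : H.Good) (k : ℕ) : (H.iterLine k).Good := by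
  induction k with
  | zero => exact h
  | succ k ih => exact ih.line

theorem Good.card_lt {H : Digraph'} [Finite H.V] (h : H.Good) :
    Nat.card H.V < Nat.card H.line.V := by
  have := finite_line H
  let π : H.line.V → H.V := fun e => e.val.1
  have hs : Function.Surjective π := fun u => by
    obtain ⟨v, hv⟩ := h.out u
    exact ⟨⟨(u, v), hv⟩, rfl⟩
  refine lt_of_le_of_ne (Nat.card_le_card_of_surjective π hs) ?_
  intro heq
  have hb : Function.Bijective π := (Nat.bijective_iff_surjective_and_card π).2 ⟨hs, heq.symm⟩
  obtain ⟨u, v, w, hv, hw, hne⟩ := h.br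
  have := @hb.1 ⟨(u, v), hv⟩ ⟨(u, w), hw⟩ rfl
  exact hne (congrArg (fun e : H.line.V => e.val.2) this)

theorem Good.le_card {H : Digraph'} [Finite H.V] (h : H.Good) (k : ℕ) :
    k ≤ Nat.card (H.iterLine k).V := by
  induction k with
  | zero => exact Nat.zero_le _
  | succ k ih =>
    have := finite_iterLine H k
    exact lt_of_le_of_lt ih (h.iterLine k).card_lt

/-- Injective homomorphism. -/
def Emb (H G : Digraph') : Prop :=
  ∃ f : H.V → G.V, Function.Injective f ∧ ∀ u v, H.Adj u v → G.Adj (f u) (f v)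

theorem Emb.line {H G : Digraph'} (h : Emb H G) : Emb H.line G.line := by
  obtain ⟨f, hf, hfa⟩ := h
  refine ⟨fun e => ⟨(f e.val.1, f e.val.2), hfa _ _ e.2⟩, ?_, ?_⟩
  · rintro ⟨⟨a, b⟩, h1⟩ ⟨⟨c, d⟩, h2⟩ h
    have h' := congrArg (fun e : G.line.V => e.val) h
    simp only [Prod.mk.injEq] at h'
    have e1 : a = c := hf h'.1
    have e2 : b = d := hf h'.2
    subst e1 e2
    rfl
  · intro u v huv
    exact congrArg f huv

theorem Emb.iterLine {H G : Digraph'} (h : Emb H G) (k : ℕ) :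
    Emb (H.iterLine k) (G.iterLine k) := by
  induction k with
  | zero => exact h
  | succ k ih => exact ih.line

theorem hasWalk_map {H G : Digraph'} {f : H.V → G.V}
    (hf : ∀ u v, H.Adj u v → G.Adj (f u) (f v)) (k : ℕ) :
    ∀ u v, H.HasWalk k u v → G.HasWalk k (f u) (f v) := by
  induction k with
  | zero => intro u v h; exact congrArg f h
  | succ k ih =>
    rintro u v ⟨w, hw, hwv⟩
    exact ⟨f w, hf _ _ hw, ih _ _ hwv⟩

theorem card_le_of_innerDiam_lt {H G : Digraph'} [Finite G.V] {D N : ℕ} (hD : G.OutBdd D)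
    (hE : Emb H G) (hsc : H.StronglyConnected) (hN : G.innerDiam < N) :
    Nat.card H.V ≤ ∑ i ∈ Finset.range N, D ^ i := by
  classical
  obtain ⟨f, hf, hfa⟩ := hE
  rcases isEmpty_or_nonempty H.V with hem | ⟨⟨u⟩⟩
  · simp
  choose T hT hTm using fun k => hD.walk k (f u)
  have hbd : BddAbove {n | ∃ u v : G.V, G.Reachable u v ∧ G.dist u v = n} := by
    apply Set.Finite.bddAbove
    apply (Set.finite_range (fun p : G.V × G.V => G.dist p.1 p.2)).subset
    rintro n ⟨a, b, -, h⟩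
    exact ⟨(a, b), h⟩
  have hmem : ∀ v, f v ∈ (Finset.range N).biUnion T := by
    intro v
    obtain ⟨k, hk⟩ := hsc u v
    have hr : G.Reachable (f u) (f v) := ⟨k, hasWalk_map hfa k _ _ hk⟩
    have hw : G.HasWalk (G.dist (f u) (f v)) (f u) (f v) := Nat.sInf_mem hr
    have hle : G.dist (f u) (f v) ≤ G.innerDiam := le_csSup hbd ⟨_, _, hr, rfl⟩
    exact Finset.mem_biUnion.2 ⟨_, Finset.mem_range.2 (by omega), hTm _ _ hw⟩
  calc Nat.card H.V ≤ Nat.card ((Finset.range N).biUnion T) :=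
        Nat.card_le_card_of_injective (fun v => (⟨f v, hmem v⟩ : ((Finset.range N).biUnion T)))
          (fun a b hab => hf (congrArg Subtype.val hab))
    _ = ((Finset.range N).biUnion T).card := by
        rw [Nat.card_eq_fintype_card, Fintype.card_coe]
    _ ≤ ∑ i ∈ Finset.range N, (T i).card := Finset.card_biUnion_le
    _ ≤ _ := Finset.sum_le_sum (fun i _ => hT i)

theorem good_of_not_cycle {H : Digraph'} (harc : ∃ u v : H.V, H.Adj u v)
    (hsc : H.StronglyConnected) (hnc : ¬ H.IsDirectedCycle) : H.Good := by
  obtain ⟨x, y, hxy⟩ := harc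
  have hout : ∀ u : H.V, ∃ v, H.Adj u v := by
    intro u
    obtain ⟨k, hk⟩ := hsc u x
    cases k with
    | zero =>
      have : u = x := hk
      exact ⟨y, this ▸ hxy⟩
    | succ k =>
      obtain ⟨w, hw, -⟩ := hk
      exact ⟨w, hw⟩
  have hlast : ∀ k (u v w : H.V), H.Adj u v → H.HasWalk k v w → ∃ z, H.Adj z w := by
    intro k
    induction k with
    | zero =>
      intro u v w h1 h2
      have : v = w := h2
      exact ⟨u, this ▸ h1⟩
    | succ k ih =>
      rintro u v w h1 ⟨z, hz, hzw⟩
      exact ih v z w hz hzw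
  refine ⟨hsc, hout, ?_, ?_⟩
  · intro v
    obtain ⟨k, hk⟩ := hsc y v
    exact hlast k x y v hxy hk
  by_contra hbr
  push Not at hbr
  apply hnc
  choose f hf using hout
  have hadj : ∀ u v, H.Adj u v ↔ v = f u := fun u v =>
    ⟨fun h => hbr u v (f u) h (hf u), fun h => h ▸ hf u⟩
  have hit : ∀ k (u v : H.V), H.HasWalk k u v → f^[k] u = v := by
    intro k
    induction k with
    | zero => intro u v h; exact h
    | succ k ih =>
      rintro u v ⟨w, hw, hwv⟩
      rw [hadj] at hw
      subst hw
      exact ih _ _ hwv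
  have hreach : ∀ u v : H.V, ∃ k, f^[k] u = v := fun u v => by
    obtain ⟨k, hk⟩ := hsc u v
    exact ⟨k, hit k u v hk⟩
  have hper : x ∈ Function.periodicPts f := by
    obtain ⟨k, hk⟩ := hreach (f x) x
    exact ⟨k + 1, Nat.succ_pos _, hk⟩
  have hpos := Function.minimalPeriod_pos_of_mem_periodicPts hper
  set n := Function.minimalPeriod f x with hn
  have : NeZero n := ⟨hpos.ne'⟩
  let e : ZMod n → H.V := fun i => f^[i.val] x
  have hmod : ∀ k, f^[k % n] x = f^[k] x := fun k => by
    rw [hn]; exact Function.iterate_mod_minimalPeriod_eq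
  have he : Function.Bijective e := by
    constructor
    · intro i j hij
      exact ZMod.val_injective n
        (Function.iterate_injOn_Iio_minimalPeriod (ZMod.val_lt i) (ZMod.val_lt j) hij)
    · intro v
      obtain ⟨k, hk⟩ := hreach x v
      refine ⟨(k : ZMod n), ?_⟩
      show f^[(k : ZMod n).val] x = v
      rw [ZMod.val_natCast, hmod, hk]
  have hstep : ∀ i, e (i + 1) = f (e i) := by
    intro i
    show f^[(i + 1).val] x = f (f^[i.val] x)
    rw [ZMod.val_add, ZMod.val_one_eq_one_mod, Nat.add_mod_mod, hmod,
      Function.iterate_succ_apply']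
  refine ⟨n, hpos, (Equiv.ofBijective e he).symm, ?_⟩
  intro u v
  obtain ⟨i, rfl⟩ := he.2 u
  obtain ⟨j, rfl⟩ := he.2 v
  have hs : ∀ i, (Equiv.ofBijective e he).symm (e i) = i :=
    fun i => (Equiv.ofBijective e he).symm_apply_apply i
  rw [hadj, ← hstep]
  show e j = e (i + 1) ↔ (Equiv.ofBijective e he).symm (e j) =
    (Equiv.ofBijective e he).symm (e i) + 1
  rw [hs, hs]
  exact he.1.eq_iff

end Digraph'

/-- If `G` contains a strongly connected subdigraph `H` (with at
least one arc) that is not a directed cycle, then the inner diameters of the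
iterated line digraphs of `G` tend to infinity. -/
theorem stmt_9 (G H : Digraph') [Finite G.V]
    (ι : H.V → G.V) (hinj : Function.Injective ι)
    (hsub : ∀ u v : H.V, H.Adj u v → G.Adj (ι u) (ι v))
    (harc : ∃ u v : H.V, H.Adj u v)
    (hsc : H.StronglyConnected) (hnc : ¬ H.IsDirectedCycle) :
    Filter.Tendsto (fun k : ℕ => (G.iterLine k).innerDiam)
      Filter.atTop Filter.atTop := by
  have hg := Digraph'.good_of_not_cycle harc hsc hnc
  have : Finite H.V := Finite.of_injective ι hinj
  have hD : G.OutBdd (Nat.card G.V) := by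
    have := Fintype.ofFinite G.V
    exact fun u => ⟨Finset.univ, by simp, fun v _ => Finset.mem_univ v⟩
  have hE : Digraph'.Emb H G := ⟨ι, hinj, hsub⟩
  rw [Filter.tendsto_atTop]
  intro N
  filter_upwards [Filter.eventually_gt_atTop (∑ i ∈ Finset.range N, Nat.card G.V ^ i)] with k hk
  by_contra hlt
  have := Digraph'.finite_iterLine G k
  have h1 := Digraph'.card_le_of_innerDiam_lt (hD.iterLine k) (hE.iterLine k)
    (hg.iterLine k).sc (not_le.1 hlt)
  have h2 := hg.le_card k
  omega
end

section
/- Let G = (V,E) be a digraph on n vertices and let π = (V₁,…,V_m) be a regular partition of V with quotient matrix B, i.e., for all i,j every vertex of V_i has exactly B_{ij} out-neighbors in V_j (counting arcs). Let m(x) = x^r − α_{r−1}x^{r−1} − ⋯ − α₀ be the minimal polynomial of B. Then the number n_k of vertices of the k-iterated line digraph L^kG satisfies the linear recurrence n_k = α_{r−1} n_{k−1} + ⋯ + α₀ n_{k−r} for all k ≥ r, and for every k ≥ 0 one has n_k = s B^k jᵀ, where s = (|V₁|,…,|V_m|) and j = (1,…,1). -/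
/-- The regular-partition data pass to the line digraph with the same quotient matrix. -/
theorem aux_line (G : Digraph') (hfin : Finite G.V) (m : ℕ) (B : Matrix (Fin m) (Fin m) ℚ)
    (c : G.V → Fin m)
    (hreg : ∀ v j, (Nat.card {w : G.V // c w = j ∧ G.Adj v w} : ℚ) = B (c v) j) :
    Finite G.line.V ∧ ∃ c' : G.line.V → Fin m,
      (∀ v j, (Nat.card {w : G.line.V // c' w = j ∧ G.line.Adj v w} : ℚ) = B (c' v) j) ∧
      ∀ j, (Nat.card {w : G.line.V // c' w = j} : ℚ) =
        ∑ i, (Nat.card {w : G.V // c w = i} : ℚ) * B i j := by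
  classical
  have hf : Finite G.line.V :=
    inferInstanceAs (Finite {p : G.V × G.V // G.Adj p.1 p.2})
  refine ⟨hf, fun a => c a.val.2, ?_, ?_⟩
  · intro a j
    rw [← hreg a.val.2 j]
    congr 1
    refine Nat.card_congr
      { toFun := fun b => ⟨b.1.val.2, b.2.1, ?_⟩
        invFun := fun w => ⟨⟨(a.val.2, w.1), w.2.2⟩, w.2.1, rfl⟩
        left_inv := ?_
        right_inv := fun w => rfl }
    · have h1 : a.val.2 = b.1.val.1 := b.2.2
      rw [h1]
      exact b.1.2
    · rintro ⟨⟨⟨u, v⟩, h⟩, h1, h2⟩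
      have h3 : a.val.2 = u := h2
      subst h3
      rfl
  · intro j
    have e : {w : G.line.V // c w.val.2 = j} ≃
        (Σ v : G.V, {w : G.V // c w = j ∧ G.Adj v w}) :=
      { toFun := fun b => ⟨b.1.val.1, b.1.val.2, b.2, b.1.2⟩
        invFun := fun x => ⟨⟨(x.1, x.2.1), x.2.2.2⟩, x.2.2.1⟩
        left_inv := fun b => rfl
        right_inv := fun x => rfl }
    have := Fintype.ofFinite G.V
    rw [Nat.card_congr e, Nat.card_sigma]
    push_cast
    simp_rw [hreg]
    rw [← Finset.sum_fiberwise Finset.univ c]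
    refine Finset.sum_congr rfl fun i _ => ?_
    rw [Finset.sum_congr rfl (g := fun _ => B i j)
      (fun x hx => by rw [(Finset.mem_filter.mp hx).2])]
    rw [Finset.sum_const, nsmul_eq_mul, Nat.card_eq_fintype_card, Fintype.card_subtype]

theorem aux_iter (G : Digraph') (hfin : Finite G.V) (m : ℕ) (B : Matrix (Fin m) (Fin m) ℚ)
    (c : G.V → Fin m)
    (hreg : ∀ v j, (Nat.card {w : G.V // c w = j ∧ G.Adj v w} : ℚ) = B (c v) j) (k : ℕ) :
    Finite (G.iterLine k).V ∧ ∃ c' : (G.iterLine k).V → Fin m,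
      (∀ v j, (Nat.card {w : (G.iterLine k).V // c' w = j ∧ (G.iterLine k).Adj v w} : ℚ)
        = B (c' v) j) ∧
      ∀ j, (Nat.card {w : (G.iterLine k).V // c' w = j} : ℚ) =
        ∑ i, (Nat.card {w : G.V // c w = i} : ℚ) * (B ^ k) i j := by
  induction k with
  | zero =>
    refine ⟨hfin, c, hreg, fun j => ?_⟩
    simp [Matrix.one_apply, Digraph'.iterLine]
  | succ k ih =>
    obtain ⟨hf, c', h1, h2⟩ := ih
    obtain ⟨hf', c'', h3, h4⟩ := aux_line _ hf m B c' h1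
    refine ⟨hf', c'', h3, fun j => ?_⟩
    refine (h4 j).trans ?_
    simp_rw [h2, pow_succ, Matrix.mul_apply, Finset.sum_mul, Finset.mul_sum]
    rw [Finset.sum_comm]
    simp_rw [mul_assoc]

/-- If `π = (V₁,…,V_m)` is a regular partition of the vertex set of
`G` with quotient matrix `B`, and `m(x) = x^r − α_{r−1}x^{r−1} − ⋯ − α₀` is the
minimal polynomial of `B`, then the numbers `n_k` of vertices of the iterated
line digraphs `L^kG` satisfy `n_k = α_{r−1}n_{k−1} + ⋯ + α₀n_{k−r}` for `k ≥ r`,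
and `n_k = s B^k jᵀ` for every `k ≥ 0`, where `s = (|V₁|,…,|V_m|)`. -/
theorem stmt_14 (G : Digraph') [Finite G.V] (m : ℕ) (P : Fin m → Set G.V)
    (hpart : ∀ v : G.V, ∃! i : Fin m, v ∈ P i)
    (B : Matrix (Fin m) (Fin m) ℚ)
    (hreg : ∀ (i j : Fin m), ∀ v ∈ P i,
      (Nat.card {w : G.V // w ∈ P j ∧ G.Adj v w} : ℚ) = B i j) :
    (∀ k : ℕ, (minpoly ℚ B).natDegree ≤ k →
      (Nat.card (G.iterLine k).V : ℚ) =
        ∑ i ∈ Finset.range (minpoly ℚ B).natDegree,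
          (-(minpoly ℚ B).coeff i) *
            (Nat.card (G.iterLine (k - (minpoly ℚ B).natDegree + i)).V : ℚ)) ∧
    (∀ k : ℕ, (Nat.card (G.iterLine k).V : ℚ) =
      ∑ i : Fin m, ∑ j : Fin m, (Nat.card (P i) : ℚ) * (B ^ k) i j) := by
  classical
  have key : ∀ k : ℕ, (Nat.card (G.iterLine k).V : ℚ) =
      ∑ i : Fin m, ∑ j : Fin m, (Nat.card (P i) : ℚ) * (B ^ k) i j := by
    intro k
    choose c hc huniq using hpart
    have hiff : ∀ v i, v ∈ P i ↔ c v = i := fun v i =>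
      ⟨fun h => (huniq v i h).symm, fun h => h ▸ hc v⟩
    have hreg' : ∀ v j, (Nat.card {w : G.V // c w = j ∧ G.Adj v w} : ℚ) = B (c v) j := by
      intro v j
      rw [← hreg (c v) j v (hc v)]
      simp_rw [hiff]
    obtain ⟨hf, c', -, h2⟩ := aux_iter G inferInstance m B c hreg' k
    have hP : ∀ i, Nat.card (P i) = Nat.card {w : G.V // c w = i} := fun i =>
      Nat.card_congr (Equiv.subtypeEquivRight fun v => hiff v i)
    rw [Nat.card_congr (Equiv.sigmaFiberEquiv c').symm, Nat.card_sigma]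
    push_cast
    simp_rw [h2, hP]
    exact Finset.sum_comm
  refine ⟨fun k hk => ?_, key⟩
  have hint : IsIntegral ℚ B := Matrix.isIntegral B
  have h0 := minpoly.aeval ℚ B
  rw [Polynomial.aeval_eq_sum_range, Finset.sum_range_succ,
    show (minpoly ℚ B).coeff (minpoly ℚ B).natDegree = 1 from minpoly.monic hint, one_smul] at h0
  set r := (minpoly ℚ B).natDegree with hr
  have h1 : B ^ k = ∑ i ∈ Finset.range r, (-(minpoly ℚ B).coeff i) • B ^ (k - r + i) := by
    have h2 : B ^ r = ∑ i ∈ Finset.range r, (-(minpoly ℚ B).coeff i) • B ^ i := by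
      rw [eq_neg_of_add_eq_zero_right h0, ← Finset.sum_neg_distrib]
      simp_rw [neg_smul]
    conv_lhs => rw [← Nat.sub_add_cancel hk, pow_add, h2, Finset.mul_sum]
    simp_rw [mul_smul_comm, ← pow_add]
  rw [key k]
  simp_rw [key, h1, Matrix.sum_apply, Matrix.smul_apply, smul_eq_mul, Finset.mul_sum]
  conv_rhs => rw [Finset.sum_comm]
  refine Finset.sum_congr rfl fun i _ => ?_
  conv_rhs => rw [Finset.sum_comm]
  refine Finset.sum_congr rfl fun j _ => Finset.sum_congr rfl fun l _ => ?_
  ring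
end

section
/- For integers d ≥ 2 and ℓ ≥ 3, the cyclic Kautz digraph CK(d,ℓ) is isomorphic to the line digraph of the subKautz digraph sK(d,ℓ−1): CK(d,ℓ) ≅ L(sK(d,ℓ−1)). -/
/-- The subKautz digraph `sK(d, n+2)`: vertices are words of length `n+2` over an
alphabet of `d+1` symbols with no two consecutive equal symbols; there is an arc
from `a₁…a_ℓ` to `a₂…a_ℓa_{ℓ+1}` whenever `a_{ℓ+1} ≠ a₁` and `a_{ℓ+1} ≠ a_ℓ`. -/
def subKautz (d n : ℕ) : Digraph' where
  V := {a : Fin (n + 2) → Fin (d + 1) // ∀ i : Fin (n + 1), a i.castSucc ≠ a i.succ}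
  Adj a b :=
    (∀ i : Fin (n + 1), a.val i.succ = b.val i.castSucc) ∧
    b.val (Fin.last (n + 1)) ≠ a.val 0 ∧
    b.val (Fin.last (n + 1)) ≠ a.val (Fin.last (n + 1))

/-- The cyclic Kautz digraph `CK(d, n+3)`: vertices are words of length `n+3`
over an alphabet of `d+1` symbols with no two consecutive equal symbols and with
first symbol different from the last; there is an arc from `a₁…a_ℓ` to
`a₂…a_ℓa_{ℓ+1}` whenever `a_{ℓ+1} ≠ a_ℓ` and `a_{ℓ+1} ≠ a₂`. -/
def cyclicKautz (d n : ℕ) : Digraph' where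
  V := {a : Fin (n + 3) → Fin (d + 1) //
        (∀ i : Fin (n + 2), a i.castSucc ≠ a i.succ) ∧ a 0 ≠ a (Fin.last (n + 2))}
  Adj a b :=
    (∀ i : Fin (n + 2), a.val i.succ = b.val i.castSucc) ∧
    b.val (Fin.last (n + 2)) ≠ a.val (Fin.last (n + 2)) ∧
    b.val (Fin.last (n + 2)) ≠ a.val 1

/-- For `d ≥ 2` and `ℓ ≥ 3` (here `ℓ = n + 3`), the cyclic Kautz
digraph `CK(d,ℓ)` is isomorphic to the line digraph of the subKautz digraph
`sK(d,ℓ−1)`. -/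
theorem stmt_15 (d n : ℕ) (hd : 2 ≤ d) :
    (cyclicKautz d n).IsIsomorphic ((subKautz d n).line) := by
  refine ⟨⟨fun a => ⟨(⟨fun i => a.val i.castSucc, fun i => ?_⟩, ⟨fun i => a.val i.succ, fun i => ?_⟩),
      ?_, ?_, ?_⟩,
    fun p => ⟨Fin.cons (p.val.1.val 0) p.val.2.val, ?_, ?_⟩, ?_, ?_⟩, ?_⟩
  · have h := a.property.1 i.castSucc
    rwa [← Fin.castSucc_succ] at h
  · have h := a.property.1 i.succ
    rwa [← Fin.succ_castSucc] at h
  · intro i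
    exact congrArg a.val (Fin.succ_castSucc i).symm
  · exact a.property.2.symm
  · exact (a.property.1 (Fin.last (n + 1))).symm
  · obtain ⟨⟨p, q⟩, hpq, h1, h2⟩ := p
    intro i
    refine Fin.cases ?_ (fun j => ?_) i
    · have h := p.property 0
      rw [hpq 0] at h
      exact h
    · exact q.property j
  · exact p.property.2.1.symm
  · intro a
    apply Subtype.ext
    funext i
    refine Fin.cases ?_ (fun j => ?_) i <;> rfl
  · rintro ⟨⟨p, q⟩, hpq, h1, h2⟩
    apply Subtype.ext
    refine Prod.ext (Subtype.ext (funext fun i => ?_)) (Subtype.ext (funext fun i => rfl))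
    refine Fin.cases rfl (fun j => ?_) i
    exact (hpq j).symm
  · intro a b
    constructor
    · intro h
      exact Subtype.ext (funext h.1)
    · intro h
      have h' : ∀ i : Fin (n + 2), a.val i.succ = b.val i.castSucc :=
        fun i => congrFun (congrArg Subtype.val h) i
      refine ⟨h', ?_, ?_⟩
      · have e := h' (Fin.last (n + 1))
        have k := b.property.1 (Fin.last (n + 1))
        rw [← e] at k
        exact k.symm
      · have e := h' 0
        have k := b.property.2.symm
        intro hh
        exact k (hh.trans e)
end

section
/- For an integer d ≥ 2 and m ≥ 4, let N(m) be the number of words a₁a₂…a_m of length m over an alphabet of d+1 symbols such that a_i ≠ a_{i+1} for all 1 ≤ i ≤ m−1 and a_i ≠ a_{i+3} for all 1 ≤ i ≤ m−3. Then N(4) = d⁴ + d, N(5) = d⁵ − d⁴ + d³ + 2d² − d, and N(m) = (d−1)·N(m−1) + N(m−2) for all m ≥ 6. (Equivalently, N(k+4) is the number of vertices of the k-iterated line digraph of the cyclic Kautz digraph CK(d,4).) -/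
/-- The word condition. -/
def WordOK (d m : ℕ) (a : Fin m → Fin (d + 1)) : Prop :=
  (∀ (i : ℕ) (h : i + 1 < m), a ⟨i, by omega⟩ ≠ a ⟨i + 1, h⟩) ∧
  (∀ (i : ℕ) (h : i + 3 < m), a ⟨i, by omega⟩ ≠ a ⟨i + 3, h⟩)

open Classical in
/-- Number of good words as a sum. -/
noncomputable def wordCount (d m : ℕ) : ℕ :=
  ∑ a : Fin m → Fin (d + 1), if WordOK d m a then 1 else 0

lemma wordOK_cons (d m : ℕ) (c : Fin (d + 1)) (a : Fin m → Fin (d + 1)) :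
    WordOK d (m + 1) (Fin.cons c a : Fin (m + 1) → Fin (d + 1)) ↔
      WordOK d m a ∧ (∀ h : 0 < m, c ≠ a ⟨0, h⟩) ∧ (∀ h : 2 < m, c ≠ a ⟨2, h⟩) := by
  constructor
  · rintro ⟨h1, h3⟩
    refine ⟨⟨fun i h => h1 (i + 1) (by omega), fun i h => h3 (i + 1) (by omega)⟩,
      fun h => ?_, fun h => ?_⟩
    · have := h1 0 (by omega)
      exact this
    · have := h3 0 (by omega)
      exact this
  · rintro ⟨⟨h1, h3⟩, h, h'⟩
    refine ⟨fun i hi => ?_, fun i hi => ?_⟩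
    · cases i with
      | zero => exact h (by omega)
      | succ i => exact h1 i (by omega)
    · cases i with
      | zero => exact h' (by omega)
      | succ i => exact h3 i (by omega)

lemma sum_cons (d m : ℕ) (f : (Fin (m + 1) → Fin (d + 1)) → ℕ) :
    ∑ a, f a = ∑ a : Fin m → Fin (d + 1), ∑ c : Fin (d + 1), f (Fin.cons c a) := by
  rw [← (Fin.consEquiv (fun _ : Fin (m + 1) => Fin (d + 1))).sum_comp,
    Fintype.sum_prod_type_right]
  rfl

lemma count_ne (d : ℕ) (x : Fin (d + 1)) :
    (∑ c : Fin (d + 1), if c ≠ x then 1 else 0) = d := by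
  rw [← Finset.card_filter, Finset.filter_ne' , Finset.card_erase_of_mem (Finset.mem_univ _)]
  simp

lemma count_ne_ne (d : ℕ) (hd : 1 ≤ d) (x y : Fin (d + 1)) :
    (∑ c : Fin (d + 1), if c ≠ x ∧ c ≠ y then 1 else 0) = (d - 1) + if x = y then 1 else 0 := by
  by_cases h : x = y
  · subst h
    simp only [and_self, count_ne, if_true]
    omega
  · rw [if_neg h, ← Finset.card_filter, Finset.filter_and, Finset.filter_ne', Finset.filter_ne',
      ← Finset.erase_eq_of_notMem (s := Finset.univ.erase x ∩ Finset.univ.erase y) (a := x) (by simp)]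
    have : (Finset.univ.erase x ∩ Finset.univ.erase y).erase x
        = (Finset.univ.erase x).erase y := by
      ext z; simp; tauto
    rw [this, Finset.card_erase_of_mem (by simp [Ne.symm h]), Finset.card_erase_of_mem (by simp)]
    simp

open Classical in
lemma count_eq (d m : ℕ) :
    (∑ a : Fin (m + 3) → Fin (d + 1), if WordOK d (m + 3) a ∧ a 0 = a 2 then 1 else 0)
      = wordCount d (m + 2) := by
  rw [sum_cons, wordCount]
  refine Finset.sum_congr rfl fun b _ => ?_
  have key : ∀ c, (WordOK d (m + 3) (Fin.cons c b : Fin (m + 3) → Fin (d + 1)) ∧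
      (Fin.cons c b : Fin (m + 3) → Fin (d + 1)) 0 = (Fin.cons c b : Fin (m + 3) → Fin (d + 1)) 2)
      ↔ (c = b 1 ∧ WordOK d (m + 2) b) := by
    intro c
    have e : (Fin.cons c b : Fin (m + 3) → Fin (d + 1)) 2 = b 1 := rfl
    rw [wordOK_cons, e, Fin.cons_zero]
    constructor
    · rintro ⟨⟨h, -⟩, h'⟩; exact ⟨h', h⟩
    · rintro ⟨rfl, h⟩
      exact ⟨⟨h, fun _ => (h.1 0 (by omega)).symm, fun h2 => h.1 1 (by omega)⟩, rfl⟩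
  simp only [key]
  by_cases h : WordOK d (m + 2) b <;> simp [h]

lemma wordCount_rec (d m : ℕ) (hd : 1 ≤ d) :
    wordCount d (m + 4) = (d - 1) * wordCount d (m + 3) + wordCount d (m + 2) := by
  classical
  rw [← count_eq d m, wordCount, sum_cons, wordCount, Finset.mul_sum, ← Finset.sum_add_distrib]
  refine Finset.sum_congr rfl fun b _ => ?_
  have key : ∀ c, WordOK d (m + 4) (Fin.cons c b : Fin (m + 4) → Fin (d + 1)) ↔
      (WordOK d (m + 3) b ∧ (c ≠ b 0 ∧ c ≠ b 2)) := by
    intro c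
    rw [wordOK_cons]
    exact ⟨fun ⟨h, h0, h2⟩ => ⟨h, h0 (by omega), h2 (by omega)⟩,
      fun ⟨h, h0, h2⟩ => ⟨h, fun _ => h0, fun _ => h2⟩⟩
  simp only [key]
  by_cases h : WordOK d (m + 3) b
  · simp only [h, true_and, if_true, mul_one]
    exact count_ne_ne d hd _ _
  · simp [h]

lemma wordCount_small (d m : ℕ) (hm : m < 2) :
    wordCount d (m + 2) = d * wordCount d (m + 1) := by
  classical
  rw [wordCount, sum_cons, wordCount, Finset.mul_sum]
  refine Finset.sum_congr rfl fun b _ => ?_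
  have key : ∀ c, WordOK d (m + 2) (Fin.cons c b : Fin (m + 2) → Fin (d + 1)) ↔
      (WordOK d (m + 1) b ∧ c ≠ b 0) := by
    intro c
    rw [wordOK_cons]
    exact ⟨fun ⟨h, h0, h2⟩ => ⟨h, h0 (by omega)⟩,
      fun ⟨h, h0⟩ => ⟨h, fun _ => h0, fun _ => by omega⟩⟩
  simp only [key]
  by_cases h : WordOK d (m + 1) b
  · simp only [h, true_and, if_true, mul_one]
    exact count_ne d _
  · simp [h]

lemma wordCount_one (d : ℕ) : wordCount d 1 = d + 1 := by
  classical
  have : ∀ a, WordOK d 1 a := fun a => ⟨fun i h => by omega, fun i h => by omega⟩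
  simp [wordCount, this]

/-- For `d ≥ 2`, let `N m` be the number of words `a₁…a_m` over an
alphabet of `d+1` symbols with `a_i ≠ a_{i+1}` (for `1 ≤ i ≤ m−1`) and
`a_i ≠ a_{i+3}` (for `1 ≤ i ≤ m−3`). Then `N 4 = d⁴ + d`,
`N 5 = d⁵ − d⁴ + d³ + 2d² − d`, and `N m = (d−1)·N (m−1) + N (m−2)` for `m ≥ 6`.
(These are the numbers of vertices of the iterated line digraphs of the cyclic
Kautz digraph `CK(d,4)`.) -/
theorem stmt_17 (d : ℕ) (hd : 2 ≤ d) (N : ℕ → ℕ)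
    (hN : ∀ m : ℕ, N m = Nat.card {a : Fin m → Fin (d + 1) //
      (∀ (i : ℕ) (h : i + 1 < m), a ⟨i, by omega⟩ ≠ a ⟨i + 1, h⟩) ∧
      (∀ (i : ℕ) (h : i + 3 < m), a ⟨i, by omega⟩ ≠ a ⟨i + 3, h⟩)}) :
    N 4 = d ^ 4 + d ∧
    (N 5 : ℤ) = (d : ℤ) ^ 5 - (d : ℤ) ^ 4 + (d : ℤ) ^ 3 + 2 * (d : ℤ) ^ 2 - (d : ℤ) ∧
    ∀ m : ℕ, 6 ≤ m → N m = (d - 1) * N (m - 1) + N (m - 2) := by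
  have hc : ∀ m, N m = wordCount d m := by
    classical
    intro m
    rw [hN m, wordCount, ← Finset.card_filter, Nat.card_eq_fintype_card, Fintype.card_subtype]
    congr 1
    ext a
    rw [Finset.mem_filter, Finset.mem_filter]
    rfl
  have h2 := wordCount_small d 0 (by omega)
  have h3 := wordCount_small d 1 (by omega)
  have h4 := wordCount_rec d 0 (by omega)
  have h5 := wordCount_rec d 1 (by omega)
  simp only [zero_add, Nat.reduceAdd, wordCount_one] at h2 h3 h4 h5
  obtain ⟨e, rfl⟩ : ∃ e, d = e + 1 := ⟨d - 1, by omega⟩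
  refine ⟨?_, ?_, ?_⟩
  · rw [hc, h4, h3, h2]
    simp only [Nat.add_sub_cancel]
    ring
  · rw [hc, h5, h4, h3, h2]
    simp only [Nat.add_sub_cancel]
    push_cast
    ring
  · intro m hm
    obtain ⟨k, rfl⟩ : ∃ k, m = k + 4 := ⟨m - 4, by omega⟩
    rw [hc, hc, hc]
    exact wordCount_rec (e + 1) k (by omega)
end

section
/- For an integer d ≥ 2 and m ≥ 4, let N(m) be the number of words a₁a₂…a_m of length m over an alphabet of d+1 symbols such that a_i ≠ a_{i+1} for all 1 ≤ i ≤ m−1 and (a_i, a_{i+1}) ≠ (a_{i+2}, a_{i+3}) for all 1 ≤ i ≤ m−3 (no two consecutive equal blocks of length two). Then N(4) = d⁴ + d³ − d² − d, N(5) = d⁵ + d⁴ − 2d³ − d² + d, and N(m) = (d−1)·N(m−1) + (d−1)·N(m−2) for all m ≥ 6. (Equivalently, N(k+4) is the number of vertices of the k-iterated line digraph of the square-free digraph SF(d,4).) -/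
/-- The admissibility predicate on words of length `m`. -/
def SFGood (d m : ℕ) (a : Fin m → Fin (d + 1)) : Prop :=
  (∀ (i : ℕ) (h : i + 1 < m), a ⟨i, by omega⟩ ≠ a ⟨i + 1, h⟩) ∧
      (∀ (i : ℕ) (h : i + 3 < m),
        (a ⟨i, by omega⟩, a ⟨i + 1, by omega⟩) ≠ (a ⟨i + 2, by omega⟩, a ⟨i + 3, h⟩))

lemma SFGood.tail {d m : ℕ} {a : Fin (m + 1) → Fin (d + 1)} (h : SFGood d (m + 1) a) :
    SFGood d m (Fin.tail a) :=
  ⟨fun i hi => h.1 (i + 1) (by omega), fun i hi => h.2 (i + 1) (by omega)⟩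

lemma SFGood.cons {d m : ℕ} {w : Fin m → Fin (d + 1)} (h : SFGood d m w) (c : Fin (d + 1))
    (h1 : ∀ hm : 0 < m, c ≠ w ⟨0, hm⟩)
    (h2 : ∀ hm : 2 < m, c = w ⟨1, by omega⟩ → w ⟨0, by omega⟩ ≠ w ⟨2, hm⟩) :
    SFGood d (m + 1) (Fin.cons c w : Fin (m + 1) → Fin (d + 1)) := by
  refine ⟨?_, ?_⟩
  · rintro (_ | i) hi
    · exact h1 (by omega)
    · exact h.1 i (by omega)
  · rintro (_ | i) hi
    · intro e
      exact h2 (by omega) (congrArg Prod.fst e) (congrArg Prod.snd e)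
    · exact h.2 i (by omega)

/-- Words whose first and third letters differ. -/
def equivB (d n : ℕ) :
    {a : Fin (n + 3) → Fin (d + 1) // SFGood d (n + 3) a ∧ a ⟨0, by omega⟩ ≠ a ⟨2, by omega⟩} ≃
    Σ w : {w : Fin (n + 2) → Fin (d + 1) // SFGood d (n + 2) w},
      {c : Fin (d + 1) // c ≠ w.1 ⟨0, by omega⟩ ∧ c ≠ w.1 ⟨1, by omega⟩} where
  toFun a := ⟨⟨Fin.tail a.1, a.2.1.tail⟩, ⟨a.1 0, a.2.1.1 0 (by omega), a.2.2⟩⟩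
  invFun p := ⟨Fin.cons p.2.1 p.1.1,
    p.1.2.cons _ (fun _ => p.2.2.1) (fun _ e => absurd e p.2.2.2), p.2.2.2⟩
  left_inv a := Subtype.ext (Fin.cons_self_tail a.1)
  right_inv p := rfl

/-- Long words whose first and third letters agree. -/
def equivA (d n : ℕ) :
    {a : Fin (n + 4) → Fin (d + 1) // SFGood d (n + 4) a ∧ a ⟨0, by omega⟩ = a ⟨2, by omega⟩} ≃
    {w : Fin (n + 3) → Fin (d + 1) //
      SFGood d (n + 3) w ∧ w ⟨0, by omega⟩ ≠ w ⟨2, by omega⟩} where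
  toFun a := ⟨Fin.tail a.1, a.2.1.tail,
    fun e => a.2.1.2 0 (by omega) (Prod.ext a.2.2 e)⟩
  invFun w := ⟨Fin.cons (w.1 ⟨1, by omega⟩) w.1,
    w.2.1.cons _ (fun _ => (w.2.1.1 0 (by omega)).symm) (fun _ _ => w.2.2), rfl⟩
  left_inv a := by
    apply Subtype.ext
    refine Eq.trans ?_ (Fin.cons_self_tail a.1)
    exact congrArg (fun c => (Fin.cons c (Fin.tail a.1) : Fin (n + 4) → Fin (d + 1))) a.2.2.symm
  right_inv w := rfl

/-- Words of length three whose first and third letters agree. -/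
def equivA3 (d : ℕ) :
    {a : Fin 3 → Fin (d + 1) // SFGood d 3 a ∧ a ⟨0, by omega⟩ = a ⟨2, by omega⟩} ≃
    {w : Fin 2 → Fin (d + 1) // SFGood d 2 w} where
  toFun a := ⟨Fin.tail a.1, a.2.1.tail⟩
  invFun w := ⟨Fin.cons (w.1 ⟨1, by omega⟩) w.1,
    w.2.cons _ (fun _ => (w.2.1 0 (by omega)).symm) (fun h => absurd h (by omega)), rfl⟩
  left_inv a := by
    apply Subtype.ext
    refine Eq.trans ?_ (Fin.cons_self_tail a.1)
    exact congrArg (fun c => (Fin.cons c (Fin.tail a.1) : Fin 3 → Fin (d + 1))) a.2.2.symm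
  right_inv w := rfl

/-- Words of length two. -/
def equiv2 (d : ℕ) :
    {a : Fin 2 → Fin (d + 1) // SFGood d 2 a} ≃
    Σ x : Fin (d + 1), {c : Fin (d + 1) // c ≠ x} where
  toFun a := ⟨a.1 1, a.1 0, a.2.1 0 (by omega)⟩
  invFun p := ⟨![p.2.1, p.1], by
    refine ⟨?_, fun i h => absurd h (by omega)⟩
    intro i hi
    obtain rfl : i = 0 := by omega
    exact p.2.2⟩
  left_inv a := by
    apply Subtype.ext
    funext i
    fin_cases i <;> rfl
  right_inv p := rfl

lemma card_two (d : ℕ) : Nat.card {a : Fin 2 → Fin (d + 1) // SFGood d 2 a} = (d + 1) * d := by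
  rw [Nat.card_congr (equiv2 d), Nat.card_sigma]
  simp

lemma card_B (d n : ℕ) :
    Nat.card {a : Fin (n + 3) → Fin (d + 1) //
      SFGood d (n + 3) a ∧ a ⟨0, by omega⟩ ≠ a ⟨2, by omega⟩} =
    (d - 1) * Nat.card {w : Fin (n + 2) → Fin (d + 1) // SFGood d (n + 2) w} := by
  classical
  rw [Nat.card_congr (equivB d n), Nat.card_sigma]
  have key : ∀ x y : Fin (d + 1), x ≠ y →
      Nat.card {c : Fin (d + 1) // c ≠ x ∧ c ≠ y} = d - 1 := by
    intro x y hxy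
    rw [Nat.card_eq_fintype_card, Fintype.card_subtype]
    have : (Finset.univ.filter fun c : Fin (d + 1) => c ≠ x ∧ c ≠ y) = ({x, y} : Finset _)ᶜ := by
      ext c; simp
    rw [this, Finset.card_compl, Finset.card_pair hxy, Fintype.card_fin]
    omega
  rw [Finset.sum_congr rfl (fun w _ => key _ _ (w.2.1 0 (by omega)))]
  simp [Nat.card_eq_fintype_card, mul_comm]

lemma card_split {α : Type*} [Finite α] (p q : α → Prop) :
    Nat.card {a // p a} = Nat.card {a // p a ∧ ¬ q a} + Nat.card {a // p a ∧ q a} := by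
  classical
  have := Fintype.ofFinite α
  simp only [Nat.card_eq_fintype_card, Fintype.card_subtype]
  rw [← Finset.filter_filter, ← Finset.filter_filter, add_comm,
    Finset.card_filter_add_card_filter_not]

lemma card_three (d : ℕ) (hd : 1 ≤ d) :
    Nat.card {a : Fin 3 → Fin (d + 1) // SFGood d 3 a} = (d + 1) * d * d := by
  rw [card_split _ (fun a => a ⟨0, by omega⟩ = a ⟨2, by omega⟩), Nat.card_congr (equivA3 d)]
  have hB := (card_B d 0).trans (congrArg ((d - 1) * ·) (card_two d))
  refine (congrArg (· + _) hB).trans ?_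
  simp only [card_two]
  obtain ⟨e, rfl⟩ := Nat.exists_eq_add_of_le' hd
  simp; ring

lemma card_rec (d n : ℕ) :
    Nat.card {a : Fin (n + 4) → Fin (d + 1) // SFGood d (n + 4) a} =
    (d - 1) * Nat.card {a : Fin (n + 3) → Fin (d + 1) // SFGood d (n + 3) a} +
    (d - 1) * Nat.card {a : Fin (n + 2) → Fin (d + 1) // SFGood d (n + 2) a} := by
  rw [card_split _ (fun a => a ⟨0, by omega⟩ = a ⟨2, by omega⟩), Nat.card_congr (equivA d n),
    card_B d n]
  exact congrArg (· + _) (card_B d (n + 1))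

/-- For `d ≥ 2`, let `N m` be the number of words `a₁…a_m` over an
alphabet of `d+1` symbols with `a_i ≠ a_{i+1}` (for `1 ≤ i ≤ m−1`) and
`(a_i, a_{i+1}) ≠ (a_{i+2}, a_{i+3})` (for `1 ≤ i ≤ m−3`), i.e. with no two
consecutive equal blocks of length two. Then `N 4 = d⁴ + d³ − d² − d`,
`N 5 = d⁵ + d⁴ − 2d³ − d² + d`, and `N m = (d−1)·N (m−1) + (d−1)·N (m−2)` for
`m ≥ 6`. (These are the numbers of vertices of the iterated line digraphs of the
square-free digraph `SF(d,4)`.) -/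
theorem stmt_18 (d : ℕ) (hd : 2 ≤ d) (N : ℕ → ℕ)
    (hN : ∀ m : ℕ, N m = Nat.card {a : Fin m → Fin (d + 1) //
      (∀ (i : ℕ) (h : i + 1 < m), a ⟨i, by omega⟩ ≠ a ⟨i + 1, h⟩) ∧
      (∀ (i : ℕ) (h : i + 3 < m),
        (a ⟨i, by omega⟩, a ⟨i + 1, by omega⟩) ≠ (a ⟨i + 2, by omega⟩, a ⟨i + 3, h⟩))}) :
    (N 4 : ℤ) = (d : ℤ) ^ 4 + (d : ℤ) ^ 3 - (d : ℤ) ^ 2 - (d : ℤ) ∧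
    (N 5 : ℤ) = (d : ℤ) ^ 5 + (d : ℤ) ^ 4 - 2 * (d : ℤ) ^ 3 - (d : ℤ) ^ 2 + (d : ℤ) ∧
    ∀ m : ℕ, 6 ≤ m → N m = (d - 1) * N (m - 1) + (d - 1) * N (m - 2) := by
  have hN' : ∀ m, N m = Nat.card {a : Fin m → Fin (d + 1) // SFGood d m a} := hN
  have hrec : ∀ n, N (n + 4) = (d - 1) * N (n + 3) + (d - 1) * N (n + 2) := by
    intro n
    rw [hN', hN', hN']
    exact card_rec d n
  have h2 : N 2 = (d + 1) * d := by rw [hN', card_two]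
  have h3 : N 3 = (d + 1) * d * d := by rw [hN', card_three d (by omega)]
  have h4 := hrec 0
  have h5 := hrec 1
  norm_num at h4 h5
  refine ⟨?_, ?_, ?_⟩
  · rw [h4, h3, h2]
    push_cast [Nat.cast_sub (show 1 ≤ d by omega)]
    ring
  · rw [h5, h4, h3, h2]
    push_cast [Nat.cast_sub (show 1 ≤ d by omega)]
    ring
  · intro m hm
    obtain ⟨n, rfl⟩ := Nat.exists_eq_add_of_le' (show 4 ≤ m by omega)
    exact hrec n
end
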